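/- Let Z ⊆ ℤ^m be a set of quality ξ > 0, let n, q ≥ 1 be integers, ε ∈ (0,1/2), and α, r ≥ √(ln(2m(1+1/ε))/π)/q. Then for every z ∈ Z there is a randomized transformation T_z mapping m samples of the first-is-errorless LWE distribution in dimension n, modulus q, noise parameter α, to a tuple in T_q^{n×m} × T_q^m × (1/q)ℤ, such that: every distinguisher f with advantage ζ for extLWE_{n,m,q,(α²ξ²+r²)^{1/2},Z} (where the adversary's chosen hint vector is z) yields, by composing f with T_z, a distinguisher with advantage at least ζ − 33ε/2 for the first-is-errorless variant of LWE_{n,m,q,α}. -/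

import Mathlib

open MeasureTheory ProbabilityTheory

noncomputable section

namespace LWEPaper

/-- The torus `𝕋 = ℝ/ℤ`. -/
abbrev 𝕋 : Type := UnitAddCircle

/-- Embedding of `T_q = {0, 1/q, …, (q−1)/q} ⊆ 𝕋` (represented by `ZMod q`) into `𝕋`,
sending `x mod q` to `x/q mod 1`. -/
noncomputable def toT {q : ℕ} [NeZero q] (x : ZMod q) : 𝕋 := ZMod.toAddCircle x

/-- The continuous Gaussian `D_α` on `ℝ`, with density proportional to `exp (−π x² / α²)`
(for `α > 0`; it is the Gaussian measure with mean `0` and variance `α²/(2π)`). -/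
@[reducible] noncomputable def contGauss (α : ℝ) : Measure ℝ :=
  gaussianReal 0 (α ^ 2 / (2 * Real.pi)).toNNReal

/-- The sample space `T_qⁿ × 𝕋` of the LWE problem, with `T_qⁿ` represented by
`(ZMod q)ⁿ`. -/
abbrev Samp (n q : ℕ) : Type := (Fin n → ZMod q) × 𝕋

/-- The uniform (Haar/Lebesgue) probability distribution on `𝕋`. -/
noncomputable def uniT : Measure 𝕋 := volume

/-- The LWE distribution `A_{q,s,φ}` on `T_qⁿ × 𝕋`: choose `a` uniformly in `T_qⁿ`,
`e` from the error distribution `φ`, and output `(a, ⟨a,s⟩ + e mod 1)`. -/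
noncomputable def lweA (n q : ℕ) [NeZero q] (s : Fin n → ZMod q) (φ : Measure ℝ) :
    Measure (Samp n q) :=
  (((PMF.uniformOfFintype (Fin n → ZMod q)).toMeasure).prod φ).map
    fun ae => (ae.1, toT (∑ j, ae.1 j * s j) + ((ae.2 : ℝ) : 𝕋))

/-- `m` i.i.d. samples from `A_{q,s,φ}` (with the same secret `s` in every sample). -/
noncomputable def lweSamples (n m q : ℕ) [NeZero q] (s : Fin n → ZMod q) (φ : Measure ℝ) :
    Measure (Fin m → Samp n q) :=
  Measure.pi fun _ : Fin m => lweA n q s φ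

/-- The uniform distribution on `T_qⁿ × 𝕋`. -/
noncomputable def uniSamp (n q : ℕ) [NeZero q] : Measure (Samp n q) :=
  ((PMF.uniformOfFintype (Fin n → ZMod q)).toMeasure).prod uniT

/-- `m` i.i.d. uniform samples from `T_qⁿ × 𝕋`. -/
noncomputable def uniSamples (n m q : ℕ) [NeZero q] : Measure (Fin m → Samp n q) :=
  Measure.pi fun _ : Fin m => uniSamp n q

/-- The advantage of a (randomized) distinguisher, described by its acceptance-probability
function `f`, in distinguishing the distributions `P₀` and `P₁`. -/
noncomputable def adv {X : Type*} [MeasurableSpace X] (f : X → ℝ) (P₀ P₁ : Measure X) : ℝ :=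
  |(∫ x, f x ∂P₀) - ∫ x, f x ∂P₁|

/-- A distinguisher: a measurable acceptance-probability function with values in `[0,1]`
(this models an arbitrary, possibly randomized and not necessarily efficient,
`{0,1}`-valued algorithm). -/
def IsDistinguisher {X : Type*} [MeasurableSpace X] (f : X → ℝ) : Prop :=
  Measurable f ∧ ∀ x, f x ∈ Set.Icc (0 : ℝ) 1

/-- Applying a randomized transformation (Markov kernel) `κ` independently to each of the
`m` samples. -/
noncomputable def samplewise {S S' : Type*} [MeasurableSpace S] [MeasurableSpace S'] (m : ℕ)
    (κ : Kernel S S') (x : Fin m → S) : Measure (Fin m → S') :=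
  Measure.pi fun i => κ (x i)

/-- Euclidean norm of an integer vector. -/
noncomputable def inorm {n : ℕ} (s : Fin n → ℤ) : ℝ := Real.sqrt (∑ i, ((s i : ℝ)) ^ 2)

/-- Reduction of an integer vector modulo `q`. -/
def modq {n : ℕ} (q : ℕ) (s : Fin n → ℤ) : Fin n → ZMod q := fun i => ((s i : ℤ) : ZMod q)

/-- The statistical distance between two measures: the supremum, over measurable events,
of the discrepancy of the two measures (for probability measures this equals half the
total variation of their difference). -/
noncomputable def statDist {Ω : Type*} [MeasurableSpace Ω] (μ ν : Measure Ω) : ℝ :=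
  ⨆ A : { s : Set Ω // MeasurableSet s }, |(μ A).toReal - (ν A).toReal|

/-- A distribution `𝒟` on `ℤⁿ` is `(R,δ)`-bounded if the probability that a vector drawn
from `𝒟` has euclidean norm greater than `R` is at most `δ`. -/
def IsBounded {n : ℕ} (𝒟 : PMF (Fin n → ℤ)) (R δ : ℝ) : Prop :=
  (𝒟.toMeasure {x | R < inorm x}).toReal ≤ δ

/-- The "first-is-errorless" LWE distribution on `m` samples: the first sample is drawn
from `A_{q,s,{0}}` (error deterministically zero) and the remaining `m−1` samples are
drawn independently from `A_{q,s,φ}`. -/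
noncomputable def feLWE (n m q : ℕ) [NeZero m] [NeZero q] (s : Fin n → ZMod q)
    (φ : Measure ℝ) : Measure (Fin m → Samp n q) :=
  Measure.pi fun i : Fin m =>
    if i = 0 then lweA n q s (Measure.dirac (0 : ℝ)) else lweA n q s φ

/-- The uniform distribution on `T_q ⊆ 𝕋`. -/
noncomputable def uniTq (q : ℕ) [NeZero q] : Measure 𝕋 :=
  ((PMF.uniformOfFintype (ZMod q)).map toT).toMeasure

/-- The "first-is-errorless" uniform distribution on `m` samples: the first sample is
uniform over `T_qⁿ × T_q` and the remaining `m−1` samples are uniform over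
`T_qⁿ × 𝕋`. -/
noncomputable def feUni (n m q : ℕ) [NeZero m] [NeZero q] : Measure (Fin m → Samp n q) :=
  Measure.pi fun i : Fin m =>
    if i = 0 then ((PMF.uniformOfFintype (Fin n → ZMod q)).toMeasure).prod (uniTq q)
    else uniSamp n q

/-- Matrices over a measurable space of entries are measurable spaces (with the product
σ-algebra, entrywise). -/
instance {n m q : ℕ} : MeasurableSpace (Matrix (Fin n) (Fin m) (ZMod q)) :=
  inferInstanceAs (MeasurableSpace (Fin n → Fin m → ZMod q))

/-- A vector `z ∈ ℤ^m` has quality `ξ`: there is a unimodular `U ∈ ℤ^{m×m}` such that all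
columns of the matrix `U'` obtained from `U` by removing the leftmost column are
orthogonal to `z`, and the largest singular value of `U'` is at most `ξ`. -/
def QualityAt {m : ℕ} [NeZero m] (ξ : ℝ) (z : Fin m → ℤ) : Prop :=
  ∃ U : Matrix (Fin m) (Fin m) ℤ,
    (U.det = 1 ∨ U.det = -1) ∧
    (∀ j : Fin m, j ≠ 0 → ∑ i, z i * U i j = 0) ∧
    (∀ x : Fin m → ℝ, x 0 = 0 →
      ∑ i, ((U.map (Int.cast : ℤ → ℝ)).mulVec x i) ^ 2 ≤ ξ ^ 2 * ∑ i, (x i) ^ 2)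

/-- `dg` is the discrete Gaussian distribution `D_{ℤ^m,r}`: a probability distribution on
`ℤ^m` whose mass function is proportional to `ρ_r(x) = exp(−π‖x‖²/r²)` (expressed by
cross-proportionality, which determines the distribution uniquely).  Under the scaling
`x ↦ x/q` it represents the discrete Gaussian `D_{q⁻¹ℤ^m, r/q}`. -/
def IsDiscreteGaussian {m : ℕ} (dg : PMF (Fin m → ℤ)) (r : ℝ) : Prop :=
  ∀ x y : Fin m → ℤ,
    (dg x).toReal * Real.exp (-Real.pi * (inorm y) ^ 2 / r ^ 2)
      = (dg y).toReal * Real.exp (-Real.pi * (inorm x) ^ 2 / r ^ 2)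

/-- The `extLWE_{n,m,q,β,Z}` distribution for hint vector `z`, LWE case: the output is
`(A, b = Aᵀs + e, ⟨e,z⟩)` where `A` is uniform in `T_q^{n×m}`, `s` is uniform in
`{0,…,q−1}ⁿ` and `e ← D_{q⁻¹ℤ^m,β}`.  Everything is scaled by `q`: `A, b` are represented
over `ZMod q`, the noise `e` is represented by `q·e ← dg = D_{ℤ^m,qβ}`, and the hint
`⟨e,z⟩ ∈ q⁻¹ℤ` is represented by its numerator `q·⟨e,z⟩ = ⟨q·e, z⟩ ∈ ℤ`. -/
noncomputable def extLWE₀ (n m q : ℕ) [NeZero q] (dg : PMF (Fin m → ℤ))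
    (z : Fin m → ℤ) :
    Measure (Matrix (Fin n) (Fin m) (ZMod q) × (Fin m → ZMod q) × ℤ) :=
  ((PMF.uniformOfFintype (Matrix (Fin n) (Fin m) (ZMod q))).bind fun A =>
    (PMF.uniformOfFintype (Fin n → ZMod q)).bind fun sec =>
      dg.bind fun e =>
        PMF.pure (A, fun i => A.transpose.mulVec sec i + ((e i : ℤ) : ZMod q),
          ∑ i, z i * e i)).toMeasure

/-- The `extLWE_{n,m,q,β,Z}` distribution for hint vector `z`, uniform case: as in
`extLWE₀` but with `b` uniform in `T_q^m`, independent of everything else (the hint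
`⟨e,z⟩` for `e ← D_{q⁻¹ℤ^m,β}` is still given). -/
noncomputable def extLWE₁ (n m q : ℕ) [NeZero q] (dg : PMF (Fin m → ℤ))
    (z : Fin m → ℤ) :
    Measure (Matrix (Fin n) (Fin m) (ZMod q) × (Fin m → ZMod q) × ℤ) :=
  ((PMF.uniformOfFintype (Matrix (Fin n) (Fin m) (ZMod q))).bind fun A =>
    (PMF.uniformOfFintype (Fin m → ZMod q)).bind fun b =>
      dg.bind fun e =>
        PMF.pure (A, b, ∑ i, z i * e i)).toMeasure

theorem hasSum_pow_natAbs {d : ℝ} (h0 : 0 ≤ d) (h1 : d < 1) :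
    HasSum (fun n : ℤ => d ^ n.natAbs) ((1 + d) / (1 - d)) := by
  have hg := hasSum_geometric_of_lt_one h0 h1
  have h := HasSum.of_nat_of_neg_add_one (f := fun n : ℤ => d ^ n.natAbs)
    (m := (1 - d)⁻¹) (m' := d * (1 - d)⁻¹) (by simpa using hg) ?_
  · convert h using 1
    have : (1 - d) ≠ 0 := by linarith
    field_simp
  · refine (hg.mul_left d).congr_fun fun n => ?_
    rw [Int.natAbs_neg, show ((n : ℤ) + 1).natAbs = n + 1 by omega, pow_succ']

/-- If the terms of a two-sided series are dominated by `d ^ |n|` and the central term is `1`, the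
sum is within `2 d / (1 - d)` of `1`. -/
theorem norm_tsum_sub_one_le {d : ℝ} (h0 : 0 ≤ d) (h1 : d < 1) {c : ℤ → ℂ} (hc0 : c 0 = 1)
    (hc : ∀ n, ‖c n‖ ≤ d ^ n.natAbs) : ‖∑' n, c n - 1‖ ≤ 2 * d / (1 - d) := by
  have hs := hasSum_pow_natAbs h0 h1
  have hcs : Summable c := Summable.of_norm_bounded hs.summable hc
  have h1' : HasSum (fun n : ℤ => if n = 0 then (1 : ℂ) else 0) 1 := hasSum_ite_eq 0 1
  have h1'' : HasSum (fun n : ℤ => if n = 0 then (1 : ℝ) else 0) 1 := hasSum_ite_eq 0 1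
  have hd := hcs.hasSum.sub h1'
  have hb := hs.sub h1''
  rw [← hd.tsum_eq]
  have : 2 * d / (1 - d) = (1 + d) / (1 - d) - 1 := by
    have : (1 - d) ≠ 0 := by linarith
    field_simp; ring
  rw [this]
  refine tsum_of_norm_bounded hb fun n => ?_
  by_cases hn : n = 0
  · simp [hn, hc0]
  · simpa [hn] using hc n

/-- The one-dimensional Gaussian weight `exp (-π (k - x)² / t²)`. -/
noncomputable def gaussWeight (t x : ℝ) (k : ℤ) : ℝ := Real.exp (-Real.pi * (k - x) ^ 2 / t ^ 2)

theorem gaussWeight_pos (t x : ℝ) (k : ℤ) : 0 < gaussWeight t x k := Real.exp_pos _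

theorem gaussWeight_add_int (t x : ℝ) (j k : ℤ) :
    gaussWeight t (x + j) k = gaussWeight t x (k - j) := by
  simp only [gaussWeight, Int.cast_sub]
  ring_nf

theorem ofReal_gaussWeight (t x : ℝ) (k : ℤ) : ((gaussWeight t x k : ℝ) : ℂ) =
    Complex.exp (-Real.pi / ((t : ℂ) ^ 2) * (k + Complex.I * (Complex.I * x)) ^ 2) := by
  rw [gaussWeight, Complex.ofReal_exp]
  congr 1
  push_cast
  rw [← mul_assoc, Complex.I_mul_I]
  ring

/-- Poisson summation: the total Gaussian weight of the integers, seen from any centre, is close to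
`t`. -/
theorem gaussWeight_sum_bounds {t η : ℝ} (ht : 0 < t) (hη : η < 1)
    (hδ : 2 * Real.exp (-Real.pi * t ^ 2) / (1 - Real.exp (-Real.pi * t ^ 2)) ≤ η) (x : ℝ) :
    Summable (gaussWeight t x) ∧ (1 - η) * t ≤ ∑' k, gaussWeight t x k ∧
      ∑' k, gaussWeight t x k ≤ (1 + η) * t := by
  set d := Real.exp (-Real.pi * t ^ 2) with hd
  have hd0 : 0 ≤ d := (Real.exp_pos _).le
  have hd1 : d < 1 := by
    rw [hd, Real.exp_lt_one_iff]
    have := Real.pi_pos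
    nlinarith [mul_pos this (pow_pos ht 2)]
  have hre : 0 < (((t : ℂ) ^ 2)).re := by
    rw [← Complex.ofReal_pow, Complex.ofReal_re]; positivity
  have hP := Complex.tsum_exp_neg_quadratic hre (Complex.I * x)
  set c : ℤ → ℂ := fun n =>
    Complex.exp (-Real.pi * (t : ℂ) ^ 2 * n ^ 2 + 2 * Real.pi * (Complex.I * x) * n) with hc
  have hcn := norm_tsum_sub_one_le hd0 hd1 (c := c) (by simp [hc]) fun n => by
    rw [hc]
    simp only
    rw [Complex.norm_exp, hd, ← Real.exp_nat_mul, Real.exp_le_exp]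
    have e : (-Real.pi * (t : ℂ) ^ 2 * n ^ 2 + 2 * Real.pi * (Complex.I * x) * n)
        = ((-Real.pi * t ^ 2 * n ^ 2 : ℝ) : ℂ) + ((2 * Real.pi * x * n : ℝ) : ℂ) * Complex.I := by
      push_cast; ring
    rw [e, Complex.add_re, Complex.re_ofReal_mul, Complex.ofReal_re, Complex.I_re, mul_zero,
      add_zero]
    have h1 : ((n.natAbs : ℕ) : ℝ) ≤ (n : ℝ) ^ 2 := by
      have : (((n.natAbs : ℤ)) : ℝ) ≤ ((n ^ 2 : ℤ) : ℝ) :=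
        Int.cast_le.2 (Int.natAbs_le_self_sq n)
      simpa only [Int.cast_natCast, Int.cast_pow] using this
    have h2 : 0 < Real.pi * t ^ 2 := by positivity
    nlinarith
  have hpow : ((t : ℂ) ^ 2) ^ (1 / 2 : ℂ) = t := by
    have := Complex.ofReal_cpow (x := t ^ 2) (by positivity) (1 / 2)
    rw [← Real.sqrt_eq_rpow, Real.sqrt_sq ht.le] at this
    simpa using this.symm
  have hT : ∑' k : ℤ, ((gaussWeight t x k : ℝ) : ℂ) = t * ∑' n, c n := by
    simp_rw [ofReal_gaussWeight]
    rw [hP, hpow]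
    have : (t : ℂ) ≠ 0 := by exact_mod_cast ht.ne'
    field_simp
  rw [← Complex.ofReal_tsum] at hT
  have hab : |∑' k, gaussWeight t x k - t| ≤ η * t := by
    have : ((∑' k, gaussWeight t x k - t : ℝ) : ℂ) = t * (∑' n, c n - 1) := by
      push_cast; rw [← Complex.ofReal_tsum, hT]; ring
    rw [← Real.norm_eq_abs, ← Complex.norm_real, this, norm_mul, Complex.norm_real,
      Real.norm_of_nonneg ht.le, mul_comm]
    exact mul_le_mul_of_nonneg_right (hcn.trans hδ) ht.le
  rw [abs_le] at hab
  refine ⟨?_, by linarith, by linarith⟩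
  by_contra hns
  rw [tsum_eq_zero_of_not_summable hns] at hab
  nlinarith

/-- The numeric consequence of the parameter condition on the Gaussian widths. -/
theorem smoothing_numeric {m : ℕ} (hm : 1 ≤ m) {ε t : ℝ} (hε : 0 < ε)
    (ht : Real.sqrt (Real.log (2 * m * (1 + 1 / ε)) / Real.pi) ≤ t) :
    0 < t ∧ 2 * Real.exp (-Real.pi * t ^ 2) / (1 - Real.exp (-Real.pi * t ^ 2)) ≤ ε / m := by
  have hm' : (1 : ℝ) ≤ m := by exact_mod_cast hm
  set X : ℝ := 2 * m * (1 + 1 / ε) with hX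
  have hXe : X * ε = 2 * m * (ε + 1) := by rw [hX]; field_simp
  have hX1 : 1 < X := by
    have : 0 < 1 / ε := by positivity
    rw [hX]; nlinarith
  have hlog : 0 < Real.log X := Real.log_pos hX1
  have hs : 0 < Real.sqrt (Real.log X / Real.pi) := Real.sqrt_pos.2 (by positivity)
  have ht0 : 0 < t := hs.trans_le ht
  have hd : Real.exp (-Real.pi * t ^ 2) ≤ X⁻¹ := by
    rw [← Real.exp_log (inv_pos.2 (by linarith : 0 < X)), Real.exp_le_exp, Real.log_inv]
    have : Real.log X / Real.pi ≤ t ^ 2 := by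
      rw [← Real.sq_sqrt (by positivity : 0 ≤ Real.log X / Real.pi)]
      exact pow_le_pow_left₀ hs.le ht 2
    rw [div_le_iff₀ Real.pi_pos] at this
    linarith
  refine ⟨ht0, ?_⟩
  set d := Real.exp (-Real.pi * t ^ 2)
  have hdX : d * X ≤ 1 := by
    calc d * X ≤ X⁻¹ * X := mul_le_mul_of_nonneg_right hd (by linarith)
      _ = 1 := inv_mul_cancel₀ (by linarith)
  have hd0 : 0 < d := Real.exp_pos _
  have hd1 : d < 1 := by nlinarith
  rw [div_le_div_iff₀ (by linarith) (by linarith)]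
  have h : d * (2 * m * (ε + 1)) ≤ ε := by
    rw [← hXe]; nlinarith
  nlinarith

/-- The total Gaussian weight of `ℤ` as an extended nonnegative real. -/
noncomputable def gaussTotal (t x : ℝ) : ENNReal := ∑' k : ℤ, ENNReal.ofReal (gaussWeight t x k)

/-- The discrete Gaussian on `ℤ` of width `t` centred at `x`. -/
noncomputable def roundMeasure (t x : ℝ) : Measure ℤ :=
  Measure.count.withDensity fun k => ENNReal.ofReal (gaussWeight t x k) / gaussTotal t x

theorem roundMeasure_singleton (t x : ℝ) (k : ℤ) :
    roundMeasure t x {k} = ENNReal.ofReal (gaussWeight t x k) / gaussTotal t x := by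
  rw [roundMeasure, withDensity_apply _ (measurableSet_singleton k), lintegral_singleton,
    Measure.count_singleton, mul_one]

theorem gaussTotal_ne_zero (t x : ℝ) : gaussTotal t x ≠ 0 := by
  intro h
  rw [gaussTotal, ENNReal.tsum_eq_zero] at h
  exact absurd (h 0) (by simpa using gaussWeight_pos t x 0)

theorem gaussTotal_add_int (t x : ℝ) (j : ℤ) : gaussTotal t (x + j) = gaussTotal t x := by
  simp_rw [gaussTotal, gaussWeight_add_int]
  exact (Equiv.subRight j).tsum_eq fun k => ENNReal.ofReal (gaussWeight t x k)

instance roundMeasure_sigmaFinite (t x : ℝ) : SigmaFinite (roundMeasure t x) := by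
  refine SigmaFinite.withDensity_of_ne_top ?_
  exact Filter.Eventually.of_forall fun k =>
    (ENNReal.div_lt_top ENNReal.ofReal_ne_top (gaussTotal_ne_zero t x)).ne

theorem roundMeasure_isProbabilityMeasure {t x : ℝ} (h : gaussTotal t x ≠ ⊤) :
    IsProbabilityMeasure (roundMeasure t x) := by
  constructor
  rw [roundMeasure, withDensity_apply _ MeasurableSet.univ, Measure.restrict_univ, lintegral_count]
  simp_rw [div_eq_mul_inv]
  rw [ENNReal.tsum_mul_right]
  exact ENNReal.mul_inv_cancel (gaussTotal_ne_zero t x) h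

theorem gaussTotal_eq {t x : ℝ} (h : Summable (gaussWeight t x)) :
    gaussTotal t x = ENNReal.ofReal (∑' k, gaussWeight t x k) :=
  (ENNReal.ofReal_tsum_of_nonneg (fun k => (gaussWeight_pos t x k).le) h).symm

theorem measurable_gaussWeight (t : ℝ) (k : ℤ) : Measurable fun x => gaussWeight t x k := by
  unfold gaussWeight; fun_prop

theorem measurable_gaussTotal (t : ℝ) : Measurable (gaussTotal t) :=
  Measurable.tsum fun k => (measurable_gaussWeight t k).ennreal_ofReal

theorem measurable_roundMeasure_singleton (t : ℝ) (k : ℤ) :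
    Measurable fun x => roundMeasure t x {k} := by
  simp_rw [roundMeasure_singleton]
  exact (measurable_gaussWeight t k).ennreal_ofReal.div (measurable_gaussTotal t)

theorem measurable_measure_of_singleton {α β : Type*} [MeasurableSpace α] [MeasurableSpace β]
    [Countable β] [MeasurableSingletonClass β] {μ : α → Measure β}
    (h : ∀ b, Measurable fun a => μ a {b}) : Measurable μ := by
  refine Measure.measurable_of_measurable_coe _ fun s hs => ?_
  have : ∀ a, μ a s = ∑' b : s, μ a {(b : β)} := fun a => by
    rw [← measure_biUnion (Set.to_countable s) (fun x _ y _ hxy => by simpa using hxy)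
      (fun b _ => measurableSet_singleton b), Set.biUnion_of_singleton]
  simp_rw [this]
  exact Measurable.tsum fun b => h b

/-- Coordinatewise discrete Gaussian rounding, as a kernel. -/
noncomputable def roundKernel (m : ℕ) (t : ℝ) : Kernel (Fin m → ℝ) (Fin m → ℤ) where
  toFun y := Measure.pi fun i => roundMeasure t (y i)
  measurable' := measurable_measure_of_singleton fun w => by
    simp_rw [Measure.pi_singleton]
    exact Finset.measurable_prod _ fun i _ =>
      (measurable_roundMeasure_singleton t (w i)).comp (measurable_pi_apply i)

theorem roundKernel_singleton {m : ℕ} (t : ℝ) (y : Fin m → ℝ) (w : Fin m → ℤ) :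
    roundKernel m t y {w} = ∏ i, roundMeasure t (y i) {w i} :=
  Measure.pi_singleton _ _

theorem roundKernel_isMarkovKernel {m : ℕ} {t : ℝ} (h : ∀ x, gaussTotal t x ≠ ⊤) :
    IsMarkovKernel (roundKernel m t) := by
  refine ⟨fun y => ?_⟩
  have := fun i => roundMeasure_isProbabilityMeasure (h (y i))
  exact inferInstanceAs (IsProbabilityMeasure (Measure.pi fun i => roundMeasure t (y i)))

theorem lintegral_roundKernel_add_int {m : ℕ} (t : ℝ) (y : Fin m → ℝ) (k : Fin m → ℤ)
    (h : (Fin m → ℤ) → ENNReal) :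
    ∫⁻ w, h w ∂(roundKernel m t (fun i => y i + k i)) = ∫⁻ w, h (k + w) ∂(roundKernel m t y) := by
  rw [lintegral_countable', lintegral_countable', ← (Equiv.addLeft k).tsum_eq]
  refine tsum_congr fun w => ?_
  simp only [roundKernel_singleton, roundMeasure_singleton, gaussTotal_add_int,
    gaussWeight_add_int, Equiv.coe_addLeft, Pi.add_apply, add_sub_cancel_left]

theorem lintegral_contGauss {A : ℝ} (hA : 0 < A) {f : ℝ → ENNReal} (hf : Measurable f) :
    ∫⁻ x, f x ∂(contGauss A)
      = ENNReal.ofReal A⁻¹ * ∫⁻ x, ENNReal.ofReal (Real.exp (-Real.pi * x ^ 2 / A ^ 2)) * f x := by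
  have hv : (A ^ 2 / (2 * Real.pi)).toNNReal ≠ 0 := by
    rw [Ne, Real.toNNReal_eq_zero, not_le]; positivity
  rw [contGauss, gaussianReal_of_var_ne_zero _ hv,
    lintegral_withDensity_eq_lintegral_mul _ (measurable_gaussianPDF _ _) hf,
    ← lintegral_const_mul _ (by fun_prop)]
  refine lintegral_congr fun x => ?_
  simp only [Pi.mul_apply, gaussianPDF, gaussianPDFReal]
  rw [← mul_assoc, ← ENNReal.ofReal_mul (by positivity), Real.coe_toNNReal _ (by positivity)]
  congr 3
  · rw [show 2 * Real.pi * (A ^ 2 / (2 * Real.pi)) = A ^ 2 by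
      have := Real.pi_pos.ne'; field_simp, Real.sqrt_sq hA.le]
  · congr 1
    have := Real.pi_pos.ne'
    field_simp
    ring

/-- Gaussian convolution, up to a normalizing constant that does not depend on the point. -/
theorem lintegral_gaussWeight_contGauss {A t B : ℝ} (hA : 0 < A) (ht : 0 < t)
    (hB : B ^ 2 = A ^ 2 + t ^ 2) : ∃ K : ENNReal, ∀ k : ℤ,
      ∫⁻ x, ENNReal.ofReal (gaussWeight t x k) ∂(contGauss A)
        = K * ENNReal.ofReal (gaussWeight B 0 k) := by
  refine ⟨ENNReal.ofReal A⁻¹ *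
    ∫⁻ x : ℝ, ENNReal.ofReal (Real.exp (-Real.pi * x ^ 2 * (1 / A ^ 2 + 1 / t ^ 2))), fun k => ?_⟩
  rw [lintegral_contGauss hA (measurable_gaussWeight t k).ennreal_ofReal, mul_assoc,
    ← lintegral_mul_const _ (by fun_prop)]
  congr 1
  rw [← lintegral_sub_right_eq_self _ (-(A ^ 2 / B ^ 2 * k) : ℝ)]
  refine lintegral_congr fun x => ?_
  rw [← ENNReal.ofReal_mul (Real.exp_pos _).le, ← ENNReal.ofReal_mul (Real.exp_pos _).le]
  simp only [gaussWeight]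
  rw [← Real.exp_add, ← Real.exp_add, hB]
  congr 2
  have : A ^ 2 + t ^ 2 ≠ 0 := by positivity
  field_simp
  ring

theorem roundMeasure_contGauss_bounds {A t B η : ℝ} (hA : 0 < A) (ht : 0 < t) (hη0 : 0 ≤ η)
    (hη : η < 1) (hB : B ^ 2 = A ^ 2 + t ^ 2)
    (hδ : 2 * Real.exp (-Real.pi * t ^ 2) / (1 - Real.exp (-Real.pi * t ^ 2)) ≤ η) :
    ∃ L : ENNReal, ∀ k : ℤ,
      L * ENNReal.ofReal (gaussWeight B 0 k) ≤ ∫⁻ x, roundMeasure t x {k} ∂(contGauss A) ∧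
      ∫⁻ x, roundMeasure t x {k} ∂(contGauss A) ≤
        ENNReal.ofReal ((1 + η) / (1 - η)) * L * ENNReal.ofReal (gaussWeight B 0 k) := by
  obtain ⟨K, hK⟩ := lintegral_gaussWeight_contGauss hA ht hB
  have hb := gaussWeight_sum_bounds ht hη hδ
  have h1 : 0 < 1 - η := by linarith
  refine ⟨(ENNReal.ofReal ((1 + η) * t))⁻¹ * K, fun k => ?_⟩
  simp_rw [roundMeasure_singleton, mul_assoc, ← hK k, div_eq_mul_inv]
  have hc : ENNReal.ofReal ((1 + η) * (1 - η)⁻¹) * (ENNReal.ofReal ((1 + η) * t))⁻¹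
      = (ENNReal.ofReal ((1 - η) * t))⁻¹ := by
    rw [← ENNReal.ofReal_inv_of_pos (by positivity), ← ENNReal.ofReal_inv_of_pos (by positivity),
      ← ENNReal.ofReal_mul (by positivity)]
    congr 1
    field_simp
  rw [← mul_assoc (ENNReal.ofReal ((1 + η) * (1 - η)⁻¹)), hc,
    ← lintegral_const_mul _ (measurable_gaussWeight t k).ennreal_ofReal,
    ← lintegral_const_mul _ (measurable_gaussWeight t k).ennreal_ofReal]
  constructor
  · refine lintegral_mono fun x => ?_
    rw [mul_comm]
    gcongr
    rw [gaussTotal_eq (hb x).1]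
    exact ENNReal.ofReal_le_ofReal (hb x).2.2
  · refine lintegral_mono fun x => ?_
    rw [mul_comm]
    gcongr
    rw [gaussTotal_eq (hb x).1]
    exact ENNReal.ofReal_le_ofReal (hb x).2.1

theorem gaussTotal_ne_top {t η : ℝ} (ht : 0 < t) (hη : η < 1)
    (hδ : 2 * Real.exp (-Real.pi * t ^ 2) / (1 - Real.exp (-Real.pi * t ^ 2)) ≤ η) (x : ℝ) :
    gaussTotal t x ≠ ⊤ := by
  rw [gaussTotal_eq (gaussWeight_sum_bounds ht hη hδ x).1]
  exact ENNReal.ofReal_ne_top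

theorem IsDiscreteGaussian.apply_eq {m : ℕ} {dg : PMF (Fin m → ℤ)} {B : ℝ}
    (h : IsDiscreteGaussian dg B) (w : Fin m → ℤ) :
    dg w = dg 0 * ∏ i, ENNReal.ofReal (gaussWeight B 0 (w i)) := by
  have h0 := h w 0
  have hn : ∀ w : Fin m → ℤ, inorm w ^ 2 = ∑ i, ((w i : ℝ)) ^ 2 := fun w =>
    Real.sq_sqrt (Finset.sum_nonneg fun i _ => sq_nonneg _)
  have he : Real.exp (-Real.pi * inorm w ^ 2 / B ^ 2) = ∏ i, gaussWeight B 0 (w i) := by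
    simp only [gaussWeight]
    rw [← Real.exp_sum, hn, Finset.mul_sum, Finset.sum_div]
    simp
  rw [he, hn] at h0
  simp only [Pi.zero_apply, Int.cast_zero, ne_eq, OfNat.ofNat_ne_zero, not_false_eq_true, zero_pow,
    Finset.sum_const_zero, mul_zero, zero_div, Real.exp_zero, mul_one] at h0
  rw [← ENNReal.ofReal_toReal (PMF.apply_ne_top dg w), h0, ENNReal.ofReal_mul ENNReal.toReal_nonneg,
    ENNReal.ofReal_toReal (PMF.apply_ne_top dg 0),
    ENNReal.ofReal_prod_of_nonneg fun i _ => (gaussWeight_pos _ _ _).le]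

theorem le_smul_of_singleton_le {β : Type*} [MeasurableSpace β] [Countable β]
    [MeasurableSingletonClass β] {μ ν : Measure β} {c : ENNReal} (h : ∀ b, μ {b} ≤ c * ν {b}) :
    μ ≤ c • ν := by
  refine Measure.le_iff.2 fun s _ => ?_
  have : ∀ μ : Measure β, μ s = ∑' b : s, μ {(b : β)} := fun μ => by
    rw [← measure_biUnion (Set.to_countable s) (fun x _ y _ hxy => by simpa using hxy)
      (fun b _ => measurableSet_singleton b), Set.biUnion_of_singleton]
  rw [this μ, this (c • ν)]
  exact ENNReal.tsum_le_tsum fun b => h b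

theorem lintegral_pi_prod {ι : Type*} [Fintype ι] {X : ι → Type*} [∀ i, MeasurableSpace (X i)]
    (μ : ∀ i, Measure (X i)) [∀ i, IsProbabilityMeasure (μ i)] {f : ∀ i, X i → ENNReal}
    (hf : ∀ i, Measurable (f i)) :
    ∫⁻ x, ∏ i, f i (x i) ∂(Measure.pi μ) = ∏ i, ∫⁻ x, f i x ∂(μ i) := by
  have h := lintegral_prod_eq_prod_lintegral_of_indepFun Finset.univ
    (fun i (x : ∀ i, X i) => f i (x i))
    (iIndepFun_pi (μ := μ) fun i => (hf i).aemeasurable)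
    fun i => (hf i).comp (measurable_pi_apply i)
  rw [h]
  refine Finset.prod_congr rfl fun i _ => ?_
  exact (measurePreserving_eval μ i).lintegral_comp (hf i)

/-- A probability measure whose mass function is sandwiched between multiples of the Gaussian mass
function is dominated by the discrete Gaussian. -/
theorem IsDiscreteGaussian.le_smul_of_bounds {m : ℕ} {dg : PMF (Fin m → ℤ)} {B : ℝ}
    (h : IsDiscreteGaussian dg B) (μ : Measure (Fin m → ℤ)) [IsProbabilityMeasure μ]
    {L c : ENNReal}
    (hl : ∀ w, L * ∏ i, ENNReal.ofReal (gaussWeight B 0 (w i)) ≤ μ {w})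
    (hu : ∀ w, μ {w} ≤ c * L * ∏ i, ENNReal.ofReal (gaussWeight B 0 (w i))) :
    μ ≤ c • dg.toMeasure := by
  have hsum : ∑' w, μ {w} = 1 := by
    have := lintegral_countable' (μ := μ) (fun _ => 1)
    simpa using this.symm
  set S := ∑' w : Fin m → ℤ, ∏ i, ENNReal.ofReal (gaussWeight B 0 (w i)) with hS
  have h1 : dg 0 * S = 1 := by
    rw [hS, ← ENNReal.tsum_mul_left, ← dg.tsum_coe]
    exact tsum_congr fun w => (h.apply_eq w).symm
  have h2 : L * S ≤ 1 := by
    rw [hS, ← ENNReal.tsum_mul_left, ← hsum]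
    exact ENNReal.tsum_le_tsum hl
  have h3 : L ≤ dg 0 := by
    calc L = dg 0 * (L * S) := by rw [mul_left_comm, h1, mul_one]
      _ ≤ dg 0 * 1 := by gcongr
      _ = dg 0 := mul_one _
  refine le_smul_of_singleton_le fun w => (hu w).trans ?_
  rw [PMF.toMeasure_apply_singleton _ _ (measurableSet_singleton w), h.apply_eq w, mul_assoc]
  gcongr

/-- Rounding a spherical Gaussian gives a distribution dominated by the wider discrete Gaussian. -/
theorem IsDiscreteGaussian.bind_roundKernel_le {m : ℕ} {dg : PMF (Fin m → ℤ)} {A t B η : ℝ}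
    (h : IsDiscreteGaussian dg B) (hA : 0 < A) (ht : 0 < t) (hη0 : 0 ≤ η) (hη : η < 1)
    (hB : B ^ 2 = A ^ 2 + t ^ 2)
    (hδ : 2 * Real.exp (-Real.pi * t ^ 2) / (1 - Real.exp (-Real.pi * t ^ 2)) ≤ η) :
    (Measure.pi fun _ : Fin m => contGauss A).bind (roundKernel m t) ≤
      ENNReal.ofReal ((1 + η) / (1 - η)) ^ m • dg.toMeasure := by
  obtain ⟨L, hL⟩ := roundMeasure_contGauss_bounds hA ht hη0 hη hB hδ
  have := roundKernel_isMarkovKernel (m := m) (gaussTotal_ne_top ht hη hδ)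
  have hsing : ∀ w, (Measure.pi fun _ : Fin m => contGauss A).bind (roundKernel m t) {w}
      = ∏ i, ∫⁻ x, roundMeasure t x {w i} ∂(contGauss A) := fun w => by
    rw [Measure.bind_apply (measurableSet_singleton w) (roundKernel m t).measurable.aemeasurable]
    simp_rw [roundKernel_singleton]
    rw [lintegral_pi_prod _ fun i => measurable_roundMeasure_singleton t (w i)]
  refine h.le_smul_of_bounds _ (L := L ^ m) (fun w => ?_) fun w => ?_
  · rw [hsing, ← Fin.prod_const m L, ← Finset.prod_mul_distrib]
    exact Finset.prod_le_prod' fun i _ => (hL (w i)).1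
  · rw [hsing, ← mul_pow, ← Fin.prod_const m, ← Finset.prod_mul_distrib]
    exact Finset.prod_le_prod' fun i _ => (hL (w i)).2

theorem charFunDual_pi_gaussianReal {ι : Type*} [Fintype ι] [DecidableEq ι] (v : ι → NNReal)
    (L : StrongDual ℝ (ι → ℝ)) :
    charFunDual (Measure.pi fun i => gaussianReal 0 (v i)) L =
      Complex.exp (-((∑ i, (v i : ℝ) * L (Pi.single i 1) ^ 2 / 2 : ℝ) : ℂ)) := by
  rw [charFunDual_pi]
  have : ∀ i, charFunDual (gaussianReal 0 (v i))
      (L ∘SL ContinuousLinearMap.single ℝ (fun _ : ι => ℝ) i) =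
      Complex.exp (-(((v i : ℝ) * L (Pi.single i 1) ^ 2 / 2 : ℝ) : ℂ)) := by
    intro i
    have hfun : ⇑(L ∘SL ContinuousLinearMap.single ℝ (fun _ : ι => ℝ) i) =
        fun x : ℝ => L (Pi.single i 1) * x := by
      funext x
      have : (Pi.single i x : ι → ℝ) = x • Pi.single i 1 := by
        rw [← Pi.single_smul]; simp
      simp [this, mul_comm]
    rw [charFunDual_eq_charFun_map_one, hfun, gaussianReal_map_const_mul, charFun_gaussianReal]
    congr 1
    simp
    ring
  simp_rw [this]
  rw [← Complex.exp_sum]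
  congr 1
  push_cast
  rw [Finset.sum_neg_distrib]

/-- A linear image of independent centred Gaussians with diagonal covariance is again a vector of
independent Gaussians. -/
theorem map_mulVec_pi_gaussianReal {ι κ : Type*} [Fintype ι] [Fintype κ] [DecidableEq ι]
    [DecidableEq κ] (M : Matrix κ ι ℝ) (v : ι → NNReal) (w : κ → NNReal)
    (h : M * Matrix.diagonal (fun i => (v i : ℝ)) * M.transpose =
      Matrix.diagonal fun k => (w k : ℝ)) :
    (Measure.pi fun i => gaussianReal 0 (v i)).map (fun x => M.mulVec x) =
      Measure.pi fun k => gaussianReal 0 (w k) := by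
  have hmap : (fun x => M.mulVec x) = ⇑(LinearMap.toContinuousLinearMap M.mulVecLin) := rfl
  have hprob : IsProbabilityMeasure
      ((Measure.pi fun i => gaussianReal 0 (v i)).map (fun x => M.mulVec x)) := by
    rw [hmap]
    exact Measure.isProbabilityMeasure_map
      (LinearMap.toContinuousLinearMap M.mulVecLin).measurable.aemeasurable
  refine Measure.ext_of_charFunDual (funext fun L => ?_)
  rw [hmap, charFunDual_map, charFunDual_pi_gaussianReal,
    charFunDual_pi_gaussianReal]
  congr 3
  set l : κ → ℝ := fun k => L (Pi.single k 1) with hl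
  have hL : ∀ y : κ → ℝ, L y = ∑ k, l k * y k := by
    intro y
    have : y = ∑ k, y k • (Pi.single k 1 : κ → ℝ) := by
      ext j
      simp [Finset.sum_apply, Pi.single_apply]
    conv_lhs => rw [this]
    simp [hl, mul_comm]
  have hcol : ∀ i, (L ∘SL LinearMap.toContinuousLinearMap M.mulVecLin) (Pi.single i 1) =
      ∑ k, l k * M k i := by
    intro i
    simp [hL]
  simp_rw [hcol]
  rw [← Finset.sum_div, ← Finset.sum_div]
  congr 1
  have h1 : ∑ i, (v i : ℝ) * (∑ k, l k * M k i) ^ 2 =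
      dotProduct l ((M * Matrix.diagonal (fun i => (v i : ℝ)) * M.transpose).mulVec l) := by
    rw [← Matrix.mulVec_mulVec, ← Matrix.mulVec_mulVec, Matrix.dotProduct_mulVec, dotProduct]
    refine Finset.sum_congr rfl fun i _ => ?_
    rw [Matrix.mulVec_diagonal]
    simp only [Matrix.vecMul, Matrix.mulVec, dotProduct, Matrix.transpose_apply]
    rw [show ∑ k, M k i * l k = ∑ k, l k * M k i from
      Finset.sum_congr rfl fun k _ => mul_comm _ _]
    ring
  rw [h1, h]
  simp only [dotProduct, Matrix.mulVec_diagonal]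
  exact Finset.sum_congr rfl fun k _ => by ring

/-- Measures of product form are monotone up to constants. -/
theorem pi_le_smul_pi {ι : Type*} [Fintype ι] {X : ι → Type*} [∀ i, MeasurableSpace (X i)]
    {μ ν : ∀ i, Measure (X i)} [∀ i, IsFiniteMeasure (μ i)] [∀ i, IsFiniteMeasure (ν i)]
    {c : ENNReal} (hc : c ≠ ⊤) (h : ∀ i, μ i ≤ c • ν i) :
    Measure.pi μ ≤ c ^ Fintype.card ι • Measure.pi ν := by
  have hfin : ∀ i, IsFiniteMeasure (c • ν i) := fun i => Measure.smul_finite _ hc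
  have h1 : Measure.pi (fun i => c • ν i) = c ^ Fintype.card ι • Measure.pi ν := by
    refine Measure.pi_eq fun s _ => ?_
    simp [Measure.pi_pi, Finset.prod_mul_distrib, Finset.card_univ]
  rw [← h1]
  refine Measure.le_iff.2 fun s hs => ?_
  have h2 : (Measure.pi μ).toOuterMeasure ≤
      OuterMeasure.pi fun i => (c • ν i).toOuterMeasure := by
    refine OuterMeasure.le_pi.2 fun s _ => ?_
    change Measure.pi μ _ ≤ _
    rw [Measure.pi_pi]
    exact Finset.prod_le_prod' fun i _ => h i (s i)
  calc Measure.pi μ s ≤ (OuterMeasure.pi fun i => (c • ν i).toOuterMeasure) s := h2 s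
    _ = Measure.pi (fun i => c • ν i) s := by
      rw [Measure.pi_def, toMeasure_apply _ _ hs]

theorem setLIntegral_Ioc_add (f : ℝ → ENNReal) (a b c : ℝ) :
    ∫⁻ x in Set.Ioc (a + c) (b + c), f x = ∫⁻ x in Set.Ioc a b, f (x + c) := by
  have := (measurePreserving_add_right volume c).setLIntegral_comp_preimage_emb
    (measurableEmbedding_addRight c) f (Set.Ioc (a + c) (b + c))
  rw [← this]
  simp

theorem lintegral_eq_tsum_Ioc {p : ℝ} (hp : 0 < p) (f : ℝ → ENNReal) :
    ∫⁻ x, f x = ∑' k : ℤ, ∫⁻ x in Set.Ioc 0 p, f (x + k * p) := by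
  rw [← setLIntegral_univ, ← iUnion_Ioc_zsmul hp,
    lintegral_iUnion (fun _ => measurableSet_Ioc) (Set.pairwise_disjoint_Ioc_zsmul p)]
  refine tsum_congr fun k => ?_
  rw [← setLIntegral_Ioc_add]
  simp [add_mul, add_comm]

theorem setLIntegral_Ioc_natCast_mul {p : ℝ} (hp : 0 < p) {f : ℝ → ENNReal}
    (hf : ∀ x, f (x + p) = f x) (j : ℕ) :
    ∫⁻ x in Set.Ioc 0 (j * p), f x = j * ∫⁻ x in Set.Ioc 0 p, f x := by
  have hper : ∀ (j : ℕ) x, f (x + j * p) = f x := by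
    intro j
    induction j with
    | zero => simp
    | succ j ih =>
      intro x
      rw [Nat.cast_succ, add_mul, one_mul, ← add_assoc, hf, ih]
  induction j with
  | zero => simp
  | succ j ih =>
    have hU : Set.Ioc (0 : ℝ) ((j + 1 : ℕ) * p) =
        Set.Ioc 0 (j * p) ∪ Set.Ioc (0 + j * p) (p + j * p) := by
      rw [zero_add, Set.Ioc_union_Ioc_eq_Ioc (by positivity) (by linarith)]
      congr 1; push_cast; ring
    rw [hU, lintegral_union measurableSet_Ioc, ih, setLIntegral_Ioc_add]
    · simp_rw [hper]
      push_cast; ring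
    · rw [zero_add, Set.disjoint_left]
      intro x hx hx'
      exact absurd hx.2 (not_le.2 hx'.1)

theorem lintegral_uniformOfFintype {α : Type*} [Fintype α] [Nonempty α] [MeasurableSpace α]
    [MeasurableSingletonClass α] (f : α → ENNReal) :
    ∫⁻ a, f a ∂(PMF.uniformOfFintype α).toMeasure = (Fintype.card α : ENNReal)⁻¹ * ∑ a, f a := by
  rw [lintegral_fintype, Finset.mul_sum]
  refine Finset.sum_congr rfl fun a _ => ?_
  rw [PMF.toMeasure_apply_singleton _ _ (measurableSet_singleton a), PMF.uniformOfFintype_apply,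
    mul_comm]

theorem toT_intCast {q : ℕ} [NeZero q] (k : ℤ) : toT (k : ZMod q) = (((k : ℝ) / q : ℝ) : 𝕋) :=
  ZMod.toAddCircle_intCast k

/-- The uniform distribution on the torus is dominated by a random point of `T_q` blurred by a wide
enough Gaussian. -/
theorem uniT_le_smul {q : ℕ} [NeZero q] {α η : ℝ} (hα : 0 < α) (hη : η < 1)
    (hδ : 2 * Real.exp (-Real.pi * (q * α) ^ 2) / (1 - Real.exp (-Real.pi * (q * α) ^ 2)) ≤ η) :
    uniT ≤ ENNReal.ofReal (1 - η)⁻¹ •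
      (((PMF.uniformOfFintype (ZMod q)).toMeasure).prod (contGauss α)).map
        fun ue => toT ue.1 + ((ue.2 : ℝ) : 𝕋) := by
  have hq : (0 : ℝ) < q := by exact_mod_cast NeZero.pos q
  have h1 : 0 < 1 - η := by linarith
  have hmk : Measurable fun x : ℝ => (x : 𝕋) := AddCircle.measurable_mk'
  have hmeas : Measurable fun ue : ZMod q × ℝ => toT ue.1 + ((ue.2 : ℝ) : 𝕋) :=
    (measurable_from_top.comp measurable_fst).add (hmk.comp measurable_snd)
  refine Measure.le_iff.2 fun s hs => ?_
  set g : 𝕋 → ENNReal := s.indicator 1 with hg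
  have hgm : Measurable g := measurable_one.indicator hs
  set F : ℝ → ENNReal := fun x => (q : ENNReal)⁻¹ * ∑ u : ZMod q, g (toT u + (x : 𝕋)) with hF
  have hgu : ∀ u : ZMod q, Measurable fun x : ℝ => g (toT u + (x : 𝕋)) :=
    fun u => hgm.comp (hmk.const_add _)
  have hgp : Measurable fun ue : ZMod q × ℝ => g (toT ue.1 + ((ue.2 : ℝ) : 𝕋)) := hgm.comp hmeas
  have hFm : Measurable F := (Finset.measurable_sum _ fun u _ => hgu u).const_mul _
  have hFper : ∀ (k : ℤ) x, F (x + k * (1 / q)) = F x := by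
    intro k x
    simp only [hF]
    congr 1
    rw [← _root_.Equiv.sum_comp (Equiv.addRight (k : ZMod q)) fun u => g (toT u + (x : 𝕋))]
    refine Finset.sum_congr rfl fun u _ => ?_
    have : toT (u + (k : ZMod q)) = toT u + toT (k : ZMod q) := map_add _ _ _
    rw [Equiv.coe_addRight, this, toT_intCast, AddCircle.coe_add, mul_one_div]
    congr 1
    abel
  have hLHS : uniT s = q * ∫⁻ x in Set.Ioc 0 (1 / (q : ℝ)), F x := by
    have e1 : ∫⁻ y, g y ∂uniT = uniT s := lintegral_indicator_one hs
    have e2 : ∀ u : ZMod q, ∫⁻ x in Set.Ioc (0 : ℝ) 1, g (toT u + (x : 𝕋)) = ∫⁻ y, g y ∂uniT := by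
      intro u
      have := UnitAddCircle.lintegral_preimage 0 fun y => g (toT u + y)
      rw [zero_add] at this
      rw [this, uniT]
      exact lintegral_add_left_eq_self g (toT u)
    have hP := setLIntegral_Ioc_natCast_mul (p := 1 / (q : ℝ)) (by positivity)
      (f := F) (fun x => by simpa using hFper 1 x) q
    rw [mul_one_div_cancel hq.ne'] at hP
    rw [← hP, lintegral_const_mul _ (Finset.measurable_sum _ fun u _ => hgu u),
      lintegral_finsetSum _ fun u _ => hgu u]
    simp_rw [e2, e1]
    rw [Finset.sum_const, Finset.card_univ, ZMod.card, nsmul_eq_mul, ← mul_assoc,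
      ENNReal.inv_mul_cancel (by simpa using NeZero.ne q) (ENNReal.natCast_ne_top q), one_mul]
  have hRHS : (((PMF.uniformOfFintype (ZMod q)).toMeasure).prod (contGauss α)).map
        (fun ue => toT ue.1 + ((ue.2 : ℝ) : 𝕋)) s = ∫⁻ x, F x ∂(contGauss α) := by
    rw [← lintegral_indicator_one hs, lintegral_map hgm hmeas,
      lintegral_prod _ hgp.aemeasurable, lintegral_uniformOfFintype, ZMod.card,
      lintegral_const_mul _ (Finset.measurable_sum _ fun u _ => hgu u),
      lintegral_finsetSum _ fun u _ => hgu u]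
  have hS : ∀ x : ℝ, ENNReal.ofReal ((1 - η) * (q * α)) ≤
      ∑' k : ℤ, ENNReal.ofReal (Real.exp (-Real.pi * (x + k * (1 / q)) ^ 2 / α ^ 2)) := by
    intro x
    have hb := gaussWeight_sum_bounds (by positivity) hη hδ (-(q * x))
    refine (ENNReal.ofReal_le_ofReal hb.2.1).trans ?_
    rw [← gaussTotal_eq hb.1, gaussTotal]
    refine le_of_eq (tsum_congr fun k => ?_)
    rw [gaussWeight]
    congr 2
    field_simp
    ring
  rw [Measure.smul_apply, hRHS, lintegral_contGauss hα hFm, hLHS, smul_eq_mul,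
    lintegral_eq_tsum_Ioc (p := 1 / (q : ℝ)) (by positivity)]
  simp_rw [hFper]
  rw [← lintegral_tsum fun k => (Measurable.aemeasurable (by fun_prop))]
  simp_rw [ENNReal.tsum_mul_right]
  have hlow : ENNReal.ofReal ((1 - η) * (q * α)) * ∫⁻ x in Set.Ioc 0 (1 / (q : ℝ)), F x ≤
      ∫⁻ x in Set.Ioc 0 (1 / (q : ℝ)),
        (∑' k : ℤ, ENNReal.ofReal (Real.exp (-Real.pi * (x + k * (1 / q)) ^ 2 / α ^ 2))) * F x := by
    rw [← lintegral_const_mul _ hFm]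
    exact lintegral_mono fun x => mul_le_mul_left (hS x) _
  refine le_trans (le_of_eq ?_) (mul_le_mul_right (mul_le_mul_right hlow _) _)
  rw [← mul_assoc, ← mul_assoc, ← ENNReal.ofReal_mul (by positivity),
    ← ENNReal.ofReal_mul (by positivity), ← ENNReal.ofReal_natCast]
  congr 2
  field_simp

open scoped MatrixOrder in
/-- A square matrix whose singular values are at most `ξ` can be completed to a multiple of a
coisometry. -/
theorem exists_mul_transpose_add_eq {ι : Type*} [Fintype ι] [DecidableEq ι] (V : Matrix ι ι ℝ)
    (ξ : ℝ) (h : ∀ x : ι → ℝ, ∑ i, V.mulVec x i ^ 2 ≤ ξ ^ 2 * ∑ i, x i ^ 2) :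
    ∃ S : Matrix ι ι ℝ, V * V.transpose + S * S.transpose = ξ ^ 2 • (1 : Matrix ι ι ℝ) := by
  have hpos : (ξ ^ 2 • (1 : Matrix ι ι ℝ) - V * V.transpose).PosSemidef := by
    refine Matrix.PosSemidef.of_dotProduct_mulVec_nonneg ?_ fun y => ?_
    · rw [Matrix.IsHermitian, Matrix.conjTranspose_eq_transpose_of_trivial]
      simp
    · set x := V.transpose.mulVec y with hx
      have h1 : dotProduct y (V.mulVec x) = ∑ i, x i ^ 2 := by
        rw [Matrix.dotProduct_mulVec, ← Matrix.mulVec_transpose, ← hx, dotProduct]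
        exact Finset.sum_congr rfl fun i _ => (sq _).symm
      have h2 : (∑ i, x i ^ 2) ^ 2 ≤ (∑ i, y i ^ 2) * (ξ ^ 2 * ∑ i, x i ^ 2) := by
        have h6 := Finset.sum_mul_sq_le_sq_mul_sq Finset.univ y (V.mulVec x)
        rw [← dotProduct, h1] at h6
        refine h6.trans ?_
        gcongr
        exact h x
      have h3 : 0 ≤ ∑ i, x i ^ 2 := Finset.sum_nonneg fun i _ => sq_nonneg _
      have h4 : 0 ≤ ∑ i, y i ^ 2 := Finset.sum_nonneg fun i _ => sq_nonneg _
      have h5 : dotProduct (star y) ((ξ ^ 2 • (1 : Matrix ι ι ℝ) - V * V.transpose).mulVec y) =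
          ξ ^ 2 * ∑ i, y i ^ 2 - ∑ i, x i ^ 2 := by
        rw [Matrix.sub_mulVec, dotProduct_sub, star_trivial, ← Matrix.mulVec_mulVec, ← hx, h1,
          Matrix.smul_mulVec, Matrix.one_mulVec, dotProduct_smul, smul_eq_mul, dotProduct]
        simp_rw [sq]
      rw [h5]
      rcases h3.eq_or_lt with h0 | h0
      · rw [← h0, sub_zero]; positivity
      · nlinarith
  obtain ⟨S, hS⟩ := CStarAlgebra.nonneg_iff_eq_star_mul_self.mp hpos.nonneg
  refine ⟨star S, ?_⟩
  have : (star S).transpose = S := by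
    rw [Matrix.star_eq_conjTranspose, Matrix.conjTranspose_eq_transpose_of_trivial,
      Matrix.transpose_transpose]
  rw [this, ← hS]
  abel

/-- The noise of the `i`-th sample when the first sample is errorless. -/
noncomputable def feNoise {m : ℕ} [NeZero m] (α : ℝ) (i : Fin m) : Measure ℝ :=
  if i = 0 then Measure.dirac 0 else contGauss α

instance {m : ℕ} [NeZero m] (α : ℝ) (i : Fin m) : IsProbabilityMeasure (feNoise α i) := by
  unfold feNoise
  split_ifs <;> infer_instance

/-- The noise of `m` samples of which the first one is errorless. -/
@[reducible] noncomputable def feError (m : ℕ) [NeZero m] (α : ℝ) : Measure (Fin m → ℝ) :=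
  Measure.pi fun i : Fin m => feNoise α i

theorem map_feError_prod {m : ℕ} [NeZero m] {α ξ c : ℝ} (U S : Matrix (Fin m) (Fin m) ℝ)
    (h : U * Matrix.diagonal (fun i => if i = 0 then 0 else 1) * U.transpose + S * S.transpose =
      ξ ^ 2 • (1 : Matrix (Fin m) (Fin m) ℝ)) :
    ((feError m α).prod (Measure.pi fun _ : Fin m => contGauss α)).map
      (fun p i => c * (U.mulVec p.1 i + S.mulVec p.2 i)) =
      Measure.pi fun _ : Fin m => contGauss (c * α * ξ) := by
  set v0 : NNReal := (α ^ 2 / (2 * Real.pi)).toNNReal with hv0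
  have hv0' : (v0 : ℝ) = α ^ 2 / (2 * Real.pi) := Real.coe_toNNReal _ (by positivity)
  have hE : feError m α = Measure.pi fun i : Fin m => gaussianReal 0 (if i = 0 then 0 else v0) := by
    rw [feError]
    congr 1
    funext i
    rw [feNoise]
    split_ifs
    · rw [gaussianReal_zero_var]
    · rfl
  have hM := map_mulVec_pi_gaussianReal (Matrix.fromCols (c • U) (c • S))
    (Sum.elim (fun i : Fin m => if i = 0 then 0 else v0) fun _ => v0)
    (fun _ : Fin m => ((c * α * ξ) ^ 2 / (2 * Real.pi)).toNNReal) ?_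
  · have hprod := (measurePreserving_sumPiEquivProdPi fun i : Fin m ⊕ Fin m => gaussianReal 0
      (Sum.elim (fun i : Fin m => if i = 0 then 0 else v0) (fun _ => v0) i)).map_eq
    simp only [Sum.elim_inl, Sum.elim_inr] at hprod
    rw [← hM, hE, show contGauss α = gaussianReal 0 v0 from rfl, ← hprod,
      Measure.map_map (by fun_prop) (MeasurableEquiv.measurable _)]
    congr 1
    funext x
    ext i
    rw [Matrix.fromCols_mulVec]
    simp [Matrix.smul_mulVec, mul_add]
    rfl
  · have hd : Matrix.diagonal (fun i => ((Sum.elim (fun i : Fin m => if i = 0 then 0 else v0)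
        (fun _ => v0) i : NNReal) : ℝ)) = (α ^ 2 / (2 * Real.pi)) • Matrix.fromBlocks
        (Matrix.diagonal fun i : Fin m => if i = 0 then 0 else (1 : ℝ)) 0 0
        (Matrix.diagonal fun _ : Fin m => (1 : ℝ)) := by
      rw [Matrix.fromBlocks_diagonal, ← Matrix.diagonal_smul]
      congr 1
      funext i
      rcases i with i | i
      · by_cases hi : i = 0 <;> simp [hi, hv0']
      · simp [hv0']
    rw [hd, Matrix.diagonal_one, Matrix.mul_smul, Matrix.fromCols_mul_fromBlocks,
      Matrix.transpose_fromCols, Matrix.smul_mul, Matrix.fromCols_mul_fromRows]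
    simp only [Matrix.mul_zero, add_zero, zero_add, Matrix.mul_one, Matrix.transpose_smul,
      Matrix.smul_mul, Matrix.mul_smul]
    rw [← smul_add, ← smul_add, h, Real.coe_toNNReal _ (by positivity), smul_smul, smul_smul,
      smul_smul, Matrix.smul_one_eq_diagonal]
    congr 1
    funext i
    ring

theorem exists_noise_completion {m : ℕ} [NeZero m] {ξ : ℝ} (U : Matrix (Fin m) (Fin m) ℝ)
    (hU : ∀ x : Fin m → ℝ, x 0 = 0 → ∑ i, U.mulVec x i ^ 2 ≤ ξ ^ 2 * ∑ i, x i ^ 2) :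
    ∃ S : Matrix (Fin m) (Fin m) ℝ,
      U * Matrix.diagonal (fun i => if i = 0 then 0 else 1) * U.transpose + S * S.transpose =
        ξ ^ 2 • (1 : Matrix (Fin m) (Fin m) ℝ) := by
  set D : Matrix (Fin m) (Fin m) ℝ := Matrix.diagonal (fun i => if i = 0 then 0 else 1) with hD
  obtain ⟨S, hS⟩ := exists_mul_transpose_add_eq (U * D) ξ fun x => by
    rw [← Matrix.mulVec_mulVec]
    refine (hU _ (by simp [hD, Matrix.mulVec_diagonal])).trans ?_
    refine mul_le_mul_of_nonneg_left (Finset.sum_le_sum fun i _ => ?_) (sq_nonneg ξ)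
    rw [hD, Matrix.mulVec_diagonal]
    split_ifs
    · simp [sq_nonneg]
    · rw [one_mul]
  refine ⟨S, ?_⟩
  rw [← hS, Matrix.transpose_mul, Matrix.mul_assoc, Matrix.mul_assoc, ← Matrix.mul_assoc D]
  congr 3
  rw [hD, Matrix.diagonal_transpose, Matrix.diagonal_mul_diagonal]
  congr 1
  funext i
  split_ifs <;> simp

instance {n m q : ℕ} [NeZero q] : DiscreteMeasurableSpace (Matrix (Fin n) (Fin m) (ZMod q)) :=
  inferInstanceAs (DiscreteMeasurableSpace (Fin n → Fin m → ZMod q))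

/-- The representative in `[0, 1)` of a point of the torus. -/
noncomputable def rep (y : 𝕋) : ℝ := AddCircle.equivIco 1 0 y

theorem coe_rep (y : 𝕋) : ((rep y : ℝ) : 𝕋) = y := AddCircle.coe_equivIco

theorem measurable_rep : Measurable rep :=
  measurable_subtype_coe.comp (AddCircle.measurableEquivIco 1 0).measurable

/-- A representative of a blurred point of `T_q` is an integer multiple of `1/q` plus the blur. -/
theorem exists_rep_toT_add {q : ℕ} [NeZero q] (u : ZMod q) (e : ℝ) :
    ∃ k : ℤ, (k : ZMod q) = u ∧ rep (toT u + (e : 𝕋)) = k / q + e := by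
  have hq : (q : ℝ) ≠ 0 := by exact_mod_cast NeZero.ne q
  obtain ⟨j, rfl⟩ := ZMod.intCast_surjective u
  have h : ((rep (toT (j : ZMod q) + (e : 𝕋)) : ℝ) : 𝕋) = ((j / q + e : ℝ) : 𝕋) := by
    rw [coe_rep, toT_intCast, AddCircle.coe_add]
  rw [← sub_eq_zero, ← AddCircle.coe_sub, AddCircle.coe_eq_zero_iff] at h
  obtain ⟨l, hl⟩ := h
  refine ⟨j + l * q, by simp, ?_⟩
  have : rep (toT (j : ZMod q) + (e : 𝕋)) = l + (j / q + e) := by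
    simp at hl; linarith
  rw [this]
  push_cast
  field_simp
  ring

/-- The output of the reduction, computed from the samples and the rounded noisy vector. -/
noncomputable def outMap {n m q : ℕ} [NeZero m] [NeZero q] (z : Fin m → ℤ)
    (U : Matrix (Fin m) (Fin m) ℤ) (p : (Fin m → Samp n q) × (Fin m → ℤ)) :
    Matrix (Fin n) (Fin m) (ZMod q) × (Fin m → ZMod q) × ℤ :=
  (fun j i => ∑ k, (U i k : ZMod q) * (p.1 k).1 j, fun i => (p.2 i : ZMod q),
    ∑ i, z i * p.2 i - (∑ i, z i * U i 0) * round (q * rep (p.1 0).2))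

theorem measurable_outMap {n m q : ℕ} [NeZero m] [NeZero q] (z : Fin m → ℤ)
    (U : Matrix (Fin m) (Fin m) ℤ) : Measurable (outMap (n := n) (q := q) z U) := by
  refine Measurable.prodMk ?_ (Measurable.prodMk ?_ ?_)
  · have : (fun p : (Fin m → Samp n q) × (Fin m → ℤ) =>
        ((fun j i => ∑ k, (U i k : ZMod q) * (p.1 k).1 j : Matrix (Fin n) (Fin m) (ZMod q)))) =
        (fun a : Fin m → Fin n → ZMod q => ((fun j i => ∑ k, (U i k : ZMod q) * a k j :
          Matrix (Fin n) (Fin m) (ZMod q)))) ∘ fun p i => (p.1 i).1 := rfl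
    rw [this]
    exact Measurable.of_discrete.comp (by fun_prop)
  · exact measurable_pi_lambda _ fun i =>
      Measurable.of_discrete.comp ((measurable_pi_apply i).comp measurable_snd)
  · refine Measurable.sub ?_ (Measurable.const_mul ?_ _)
    · exact (Measurable.of_discrete (f := fun w : Fin m → ℤ => ∑ i, z i * w i)).comp measurable_snd
    · have hr : Measurable fun x : ℝ => round x := by
        simp_rw [round_eq]
        exact Int.measurable_floor.comp (measurable_id.add_const _)
      exact hr.comp ((measurable_rep.comp (by fun_prop)).const_mul _)

/-- The real vector which the reduction rounds. -/
noncomputable def centerMap {n m q : ℕ} (U S : Matrix (Fin m) (Fin m) ℝ)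
    (p : (Fin m → Samp n q) × (Fin m → ℝ)) : Fin m → ℝ :=
  fun i => q * (U.mulVec (fun j => rep (p.1 j).2) i + S.mulVec p.2 i)

theorem measurable_centerMap {n m q : ℕ} (U S : Matrix (Fin m) (Fin m) ℝ) :
    Measurable (centerMap (n := n) (q := q) U S) := by
  refine measurable_pi_lambda _ fun i => Measurable.const_mul (Measurable.add ?_ ?_) _
  · simp only [Matrix.mulVec, dotProduct]
    exact Finset.measurable_sum _ fun j _ =>
      (measurable_rep.comp (by fun_prop)).const_mul _
  · simp only [Matrix.mulVec, dotProduct]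
    fun_prop

/-- The reduction: blur the samples, apply `U`, round, and compute the hint. -/
noncomputable def reduction (n m q : ℕ) [NeZero m] [NeZero q] (z : Fin m → ℤ)
    (U : Matrix (Fin m) (Fin m) ℤ) (S : Matrix (Fin m) (Fin m) ℝ) (α t : ℝ) :
    Kernel (Fin m → Samp n q) (Matrix (Fin n) (Fin m) (ZMod q) × (Fin m → ZMod q) × ℤ) :=
  ((Kernel.deterministic Prod.fst measurable_fst ×ₖ
    (roundKernel m t).comap (centerMap (U.map (Int.cast : ℤ → ℝ)) S)
      (measurable_centerMap _ _)).map (outMap z U)) ∘ₖ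
  (Kernel.id ×ₖ Kernel.const _ (Measure.pi fun _ : Fin m => contGauss α))

theorem reduction_isMarkovKernel {n m q : ℕ} [NeZero m] [NeZero q] (z : Fin m → ℤ)
    (U : Matrix (Fin m) (Fin m) ℤ) (S : Matrix (Fin m) (Fin m) ℝ) (α t : ℝ)
    [IsMarkovKernel (roundKernel m t)] : IsMarkovKernel (reduction n m q z U S α t) := by
  have := Kernel.IsMarkovKernel.map ((Kernel.deterministic Prod.fst measurable_fst ×ₖ
    (roundKernel m t).comap (centerMap (n := n) (q := q) (U.map (Int.cast : ℤ → ℝ)) S)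
      (measurable_centerMap _ _))) (measurable_outMap z U)
  unfold reduction
  infer_instance

theorem lintegral_reduction {n m q : ℕ} [NeZero m] [NeZero q] (z : Fin m → ℤ)
    (U : Matrix (Fin m) (Fin m) ℤ) (S : Matrix (Fin m) (Fin m) ℝ) (α t : ℝ)
    [IsMarkovKernel (roundKernel m t)] (x : Fin m → Samp n q)
    (h : Matrix (Fin n) (Fin m) (ZMod q) × (Fin m → ZMod q) × ℤ → ENNReal) :
    ∫⁻ y, h y ∂(reduction n m q z U S α t x) =
      ∫⁻ g, ∫⁻ w, h (outMap z U (x, w))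
        ∂(roundKernel m t (centerMap (U.map (Int.cast : ℤ → ℝ)) S (x, g)))
        ∂(Measure.pi fun _ : Fin m => contGauss α) := by
  have hh : Measurable h := Measurable.of_discrete
  have hho : Measurable fun p => h (outMap z U p) := hh.comp (measurable_outMap z U)
  rw [reduction, Kernel.lintegral_comp _ _ _ hh, Kernel.lintegral_id_prod, Kernel.const_apply]
  · refine lintegral_congr fun g => ?_
    rw [Kernel.lintegral_map _ (measurable_outMap z U) _ hh,
      Kernel.lintegral_deterministic_prod _ _ _ hho,
      Kernel.lintegral_comap]
  · exact hh.lintegral_kernel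

theorem lintegral_feError_reduction {n m q : ℕ} [NeZero m] [NeZero q] {z : Fin m → ℤ}
    {U : Matrix (Fin m) (Fin m) ℤ} {S : Matrix (Fin m) (Fin m) ℝ} {α ξ t : ℝ}
    (hz : ∀ j : Fin m, j ≠ 0 → ∑ i, z i * U i j = 0)
    (hS : U.map (Int.cast : ℤ → ℝ) * Matrix.diagonal (fun i => if i = 0 then 0 else 1) *
      (U.map (Int.cast : ℤ → ℝ)).transpose + S * S.transpose =
      ξ ^ 2 • (1 : Matrix (Fin m) (Fin m) ℝ))
    [IsMarkovKernel (roundKernel m t)] (a : Fin m → Fin n → ZMod q) (u : Fin m → ZMod q)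
    (h : Matrix (Fin n) (Fin m) (ZMod q) × (Fin m → ZMod q) × ℤ → ENNReal) :
    ∫⁻ e, ∫⁻ y, h y ∂(reduction n m q z U S α t fun i => (a i, toT (u i) + ((e i : ℝ) : 𝕋)))
        ∂(feError m α) =
      ∫⁻ w, h (fun j i => ∑ k, (U i k : ZMod q) * a k j,
          fun i => ∑ k, (U i k : ZMod q) * u k + (w i : ZMod q), ∑ i, z i * w i)
        ∂((Measure.pi fun _ : Fin m => contGauss (q * α * ξ)).bind (roundKernel m t)) := by
  have hq : (q : ℝ) ≠ 0 := by exact_mod_cast NeZero.ne q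
  set H : (Fin m → ℤ) → ENNReal := fun w => h (fun j i => ∑ k, (U i k : ZMod q) * a k j,
    fun i => ∑ k, (U i k : ZMod q) * u k + (w i : ZMod q), ∑ i, z i * w i) with hH
  set UR := U.map (Int.cast : ℤ → ℝ) with hUR
  set c : (Fin m → ℝ) × (Fin m → ℝ) → Fin m → ℝ :=
    fun p i => q * (UR.mulVec p.1 i + S.mulVec p.2 i) with hc
  have hcm : Measurable c := by
    refine measurable_pi_lambda _ fun i => ?_
    simp only [hc, Matrix.mulVec, dotProduct]
    fun_prop
  have hpt : ∀ e : Fin m → ℝ, e 0 = 0 →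
      ∫⁻ y, h y ∂(reduction n m q z U S α t fun i => (a i, toT (u i) + ((e i : ℝ) : 𝕋))) =
      ∫⁻ g, ∫⁻ w, H w ∂(roundKernel m t (c (e, g))) ∂(Measure.pi fun _ : Fin m => contGauss α) := by
    intro e he
    choose k hk1 hk2 using fun i => exists_rep_toT_add (u i) (e i)
    rw [lintegral_reduction]
    refine lintegral_congr fun g => ?_
    have hcen : centerMap UR S ((fun i => (a i, toT (u i) + ((e i : ℝ) : 𝕋))), g) =
        fun i => c (e, g) i + ((U.mulVec k i : ℤ) : ℝ) := by
      funext i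
      simp only [centerMap, hc, hk2]
      have : UR.mulVec (fun j => (k j : ℝ) / q + e j) i =
          (U.mulVec k i : ℤ) / q + UR.mulVec e i := by
        simp only [Matrix.mulVec, dotProduct, hUR, Matrix.map_apply]
        push_cast
        rw [Finset.sum_div, ← Finset.sum_add_distrib]
        exact Finset.sum_congr rfl fun j _ => by ring
      rw [this]
      field_simp
      ring
    rw [hcen, lintegral_roundKernel_add_int t (c (e, g)) (U.mulVec k)]
    refine lintegral_congr fun w => ?_
    simp only [hH, outMap]
    congr 2
    refine Prod.ext ?_ ?_
    · funext i
      simp only [Pi.add_apply, Int.cast_add, add_left_inj, Matrix.mulVec, dotProduct]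
      push_cast
      exact Finset.sum_congr rfl fun j _ => by rw [hk1]
    · have hround : round ((q : ℝ) * rep (toT (u 0) + ((e 0 : ℝ) : 𝕋))) = k 0 := by
        rw [hk2, he, add_zero, mul_div_cancel₀ _ hq, round_intCast]
      have hzU : ∑ i, z i * U.mulVec k i = (∑ i, z i * U i 0) * k 0 := by
        simp only [Matrix.mulVec, dotProduct, Finset.mul_sum]
        rw [Finset.sum_comm, Finset.sum_eq_single 0, Finset.sum_mul]
        · exact Finset.sum_congr rfl fun i _ => by ring
        · intro j _ hj
          rw [← zero_mul (k j), ← hz j hj, Finset.sum_mul]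
          exact Finset.sum_congr rfl fun i _ => by ring
        · simp
      simp only [hround, Pi.add_apply, mul_add, Finset.sum_add_distrib, hzU]
      ring
  have hae : ∀ᵐ e ∂(feError m α), e 0 = 0 := by
    refine (measurePreserving_eval (fun i : Fin m => feNoise α i) 0).quasiMeasurePreserving.ae
      (p := fun x => x = 0) ?_
    simp [feNoise]
  have hHm : Measurable H := Measurable.of_discrete
  have hHc : Measurable fun p => ∫⁻ w, H w ∂(roundKernel m t (c p)) := hHm.lintegral_kernel.comp hcm
  rw [lintegral_congr_ae (hae.mono hpt), Measure.lintegral_bind (roundKernel m t).aemeasurable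
    hHm.aemeasurable, ← map_feError_prod UR S hS, lintegral_map hHm.lintegral_kernel hcm,
    lintegral_prod _ hHc.aemeasurable]

theorem toMeasure_uniformOfFintype_prod (α β : Type*) [Fintype α] [Fintype β] [Nonempty α]
    [Nonempty β] [MeasurableSpace α] [MeasurableSpace β] [MeasurableSingletonClass α]
    [MeasurableSingletonClass β] :
    (PMF.uniformOfFintype (α × β)).toMeasure =
      (PMF.uniformOfFintype α).toMeasure.prod (PMF.uniformOfFintype β).toMeasure := by
  refine Measure.ext_of_singleton fun p => ?_
  rw [← Prod.mk.eta (p := p), ← Set.singleton_prod_singleton, Measure.prod_prod,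
    Set.singleton_prod_singleton,
    PMF.toMeasure_apply_singleton _ _ (measurableSet_singleton _),
    PMF.toMeasure_apply_singleton _ _ (measurableSet_singleton _),
    PMF.toMeasure_apply_singleton _ _ (measurableSet_singleton _)]
  simp [ENNReal.mul_inv]

theorem pi_toMeasure_uniformOfFintype (ι α : Type*) [Fintype ι] [DecidableEq ι] [Fintype α]
    [Nonempty α] [MeasurableSpace α] [MeasurableSingletonClass α] :
    Measure.pi (fun _ : ι => (PMF.uniformOfFintype α).toMeasure) =
      (PMF.uniformOfFintype (ι → α)).toMeasure := by
  refine Measure.ext_of_singleton fun v => ?_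
  rw [Measure.pi_singleton, PMF.toMeasure_apply_singleton _ _ (measurableSet_singleton _)]
  simp_rw [PMF.toMeasure_apply_singleton _ _ (measurableSet_singleton _)]
  simp [ENNReal.inv_pow]

theorem lintegral_uniformOfFintype_comp {α β : Type*} [Fintype α] [Fintype β] [Nonempty α]
    [Nonempty β] [MeasurableSpace α] [MeasurableSpace β] [MeasurableSingletonClass α]
    [MeasurableSingletonClass β] {e : α → β} (he : e.Bijective) (f : β → ENNReal) :
    ∫⁻ a, f (e a) ∂(PMF.uniformOfFintype α).toMeasure =
      ∫⁻ b, f b ∂(PMF.uniformOfFintype β).toMeasure := by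
  rw [lintegral_uniformOfFintype, lintegral_uniformOfFintype, he.sum_comp,
    Fintype.card_of_bijective he]

theorem lintegral_toMeasure_bind {α β : Type*} [Countable α] [Countable β] [MeasurableSpace α]
    [MeasurableSpace β] [MeasurableSingletonClass α] [MeasurableSingletonClass β] (p : PMF α)
    (f : α → PMF β) (h : β → ENNReal) :
    ∫⁻ b, h b ∂(p.bind f).toMeasure = ∫⁻ a, ∫⁻ b, h b ∂(f a).toMeasure ∂p.toMeasure := by
  simp_rw [lintegral_countable', PMF.toMeasure_apply_singleton _ _ (measurableSet_singleton _),
    PMF.bind_apply]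
  simp_rw [← ENNReal.tsum_mul_left, ← ENNReal.tsum_mul_right]
  rw [ENNReal.tsum_comm]
  exact tsum_congr fun a => tsum_congr fun b => by ring

/-- Blurred samples generated from independent uniform indices. -/
theorem lintegral_pi_blurred {n m q : ℕ} [NeZero m] [NeZero q] {I : Type*} [Fintype I]
    [Nonempty I] [MeasurableSpace I] [MeasurableSingletonClass I] (b : I → Fin n → ZMod q)
    (c : I → ZMod q) (α : ℝ) {G : (Fin m → Samp n q) → ENNReal} (hG : Measurable G) :
    ∫⁻ x, G x ∂(Measure.pi fun i : Fin m => ((PMF.uniformOfFintype I).toMeasure.prod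
        (feNoise α i)).map fun p => ((b p.1, toT (c p.1) + ((p.2 : ℝ) : 𝕋)) : Samp n q)) =
      ∫⁻ v, ∫⁻ e, G (fun i => (b (v i), toT (c (v i)) + ((e i : ℝ) : 𝕋))) ∂(feError m α)
        ∂(PMF.uniformOfFintype (Fin m → I)).toMeasure := by
  have hg : Measurable fun p : I × ℝ => ((b p.1, toT (c p.1) + ((p.2 : ℝ) : 𝕋)) : Samp n q) := by
    exact Measurable.prodMk (Measurable.of_discrete.comp measurable_fst)
      (((Measurable.of_discrete (f := fun i => toT (c i))).comp measurable_fst).add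
        (AddCircle.measurable_mk'.comp measurable_snd))
  have hgm : Measurable fun (p : Fin m → I × ℝ) i =>
      ((b (p i).1, toT (c (p i).1) + (((p i).2 : ℝ) : 𝕋)) : Samp n q) :=
    measurable_pi_lambda _ fun i => hg.comp (measurable_pi_apply i)
  have hpr : ∀ i : Fin m, IsProbabilityMeasure (((PMF.uniformOfFintype I).toMeasure.prod
      (feNoise α i)).map fun p => ((b p.1, toT (c p.1) + ((p.2 : ℝ) : 𝕋)) : Samp n q)) :=
    fun i => Measure.isProbabilityMeasure_map hg.aemeasurable
  have hmp := (measurePreserving_arrowProdEquivProdArrow I ℝ (Fin m)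
    (fun _ => (PMF.uniformOfFintype I).toMeasure) (fun i => feNoise α i)).symm
  have hGm : Measurable fun (p : Fin m → I × ℝ) =>
      G (fun i => (b (p i).1, toT (c (p i).1) + (((p i).2 : ℝ) : 𝕋))) := hG.comp hgm
  have hG' : Measurable fun p : (Fin m → I) × (Fin m → ℝ) =>
      G (fun i => (b (p.1 i), toT (c (p.1 i)) + ((p.2 i : ℝ) : 𝕋))) :=
    hGm.comp (MeasurableEquiv.arrowProdEquivProdArrow I ℝ (Fin m)).symm.measurable
  rw [← Measure.pi_map_pi fun i => hg.aemeasurable, lintegral_map hG hgm,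
    ← hmp.map_eq, lintegral_map hGm (MeasurableEquiv.measurable _),
    pi_toMeasure_uniformOfFintype, ← lintegral_prod _ hG'.aemeasurable]
  rfl

theorem le_smul_of_lintegral_le {α : Type*} [MeasurableSpace α] {μ ν : Measure α} {c : ENNReal}
    (h : ∀ f : α → ENNReal, Measurable f → ∫⁻ x, f x ∂μ ≤ c * ∫⁻ x, f x ∂ν) : μ ≤ c • ν := by
  refine Measure.le_iff.2 fun s hs => ?_
  have := h (s.indicator 1) (measurable_one.indicator hs)
  rwa [lintegral_indicator_one hs, lintegral_indicator_one hs] at this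

section Unimodular

variable {m q : ℕ} {U : Matrix (Fin m) (Fin m) ℤ}

theorem isUnit_det_map_intCast (hU : U.det = 1 ∨ U.det = -1) :
    IsUnit (U.map (Int.cast : ℤ → ZMod q)).det := by
  have h : (U.map (Int.cast : ℤ → ZMod q)).det = (U.det : ZMod q) :=
    ((Int.castRingHom (ZMod q)).map_det U).symm
  rw [h]
  rcases hU with hU | hU <;> simp [hU]

theorem bijective_sum_mul_of_unimodular (hU : U.det = 1 ∨ U.det = -1) (n : ℕ) :
    Function.Bijective fun (a : Fin m → Fin n → ZMod q) =>
      Matrix.of fun (j : Fin n) (i : Fin m) => ∑ k, (U i k : ZMod q) * a k j := by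
  have h := isUnit_det_map_intCast (q := q) hU
  set M := U.map (Int.cast : ℤ → ZMod q) with hM
  have he : (fun (a : Fin m → Fin n → ZMod q) =>
      Matrix.of fun (j : Fin n) (i : Fin m) => ∑ k, (U i k : ZMod q) * a k j) =
      fun a => (M * Matrix.of a).transpose := rfl
  rw [he]
  refine Function.bijective_iff_has_inverse.2
    ⟨fun A => Matrix.of.symm (M⁻¹ * A.transpose), fun a => ?_, fun A => ?_⟩
  · simp only [Matrix.transpose_transpose, ← Matrix.mul_assoc, Matrix.nonsing_inv_mul _ h,
      Matrix.one_mul, Equiv.symm_apply_apply]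
  · simp only [Equiv.apply_symm_apply, ← Matrix.mul_assoc, Matrix.mul_nonsing_inv _ h,
      Matrix.one_mul, Matrix.transpose_transpose]

theorem bijective_mulVec_of_unimodular (hU : U.det = 1 ∨ U.det = -1) :
    Function.Bijective fun (u : Fin m → ZMod q) i => ∑ k, (U i k : ZMod q) * u k := by
  have h := isUnit_det_map_intCast (q := q) hU
  set M := U.map (Int.cast : ℤ → ZMod q) with hM
  have he : (fun (u : Fin m → ZMod q) i => ∑ k, (U i k : ZMod q) * u k) = M.mulVec := rfl
  rw [he]
  exact Function.bijective_iff_has_inverse.2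
    ⟨M⁻¹.mulVec, fun u => by simp [Matrix.nonsing_inv_mul _ h],
      fun u => by simp [Matrix.mul_nonsing_inv _ h]⟩

end Unimodular

theorem feLWE_eq_pi (n m q : ℕ) [NeZero m] [NeZero q] (sec : Fin n → ZMod q) (α : ℝ) :
    feLWE n m q sec (contGauss α) = Measure.pi fun i : Fin m =>
      ((PMF.uniformOfFintype (Fin n → ZMod q)).toMeasure.prod (feNoise α i)).map
        fun p => ((p.1, toT (∑ j, p.1 j * sec j) + ((p.2 : ℝ) : 𝕋)) : Samp n q) := by
  rw [feLWE]
  congr 1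
  funext i
  rw [feNoise]
  split_ifs <;> rfl

section Reduction

variable {n m q : ℕ} [NeZero m] [NeZero q] {z : Fin m → ℤ} {U : Matrix (Fin m) (Fin m) ℤ}
  {S : Matrix (Fin m) (Fin m) ℝ} {α ξ t : ℝ} {dg : PMF (Fin m → ℤ)} {c : ENNReal}
  [IsMarkovKernel (roundKernel m t)]

theorem lintegral_pi_blurred_reduction_le (hz : ∀ j : Fin m, j ≠ 0 → ∑ i, z i * U i j = 0)
    (hS : U.map (Int.cast : ℤ → ℝ) * Matrix.diagonal (fun i => if i = 0 then 0 else 1) *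
      (U.map (Int.cast : ℤ → ℝ)).transpose + S * S.transpose =
      ξ ^ 2 • (1 : Matrix (Fin m) (Fin m) ℝ))
    (hdg : (Measure.pi fun _ : Fin m => contGauss (q * α * ξ)).bind (roundKernel m t) ≤
      c • dg.toMeasure)
    {I : Type*} [Fintype I] [Nonempty I] [MeasurableSpace I] [MeasurableSingletonClass I]
    (b : I → Fin n → ZMod q) (s : I → ZMod q)
    (h : Matrix (Fin n) (Fin m) (ZMod q) × (Fin m → ZMod q) × ℤ → ENNReal) :
    ∫⁻ x, ∫⁻ y, h y ∂(reduction n m q z U S α t x)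
      ∂(Measure.pi fun i : Fin m => ((PMF.uniformOfFintype I).toMeasure.prod
        (feNoise α i)).map fun p => ((b p.1, toT (s p.1) + ((p.2 : ℝ) : 𝕋)) : Samp n q)) ≤
      c * ∫⁻ v, ∫⁻ w, h (fun j i => ∑ k, (U i k : ZMod q) * b (v k) j,
          fun i => ∑ k, (U i k : ZMod q) * s (v k) + (w i : ZMod q), ∑ i, z i * w i)
        ∂dg.toMeasure ∂(PMF.uniformOfFintype (Fin m → I)).toMeasure := by
  have hh : Measurable h := Measurable.of_discrete
  rw [lintegral_pi_blurred b s α hh.lintegral_kernel,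
    ← lintegral_const_mul _ Measurable.of_discrete]
  refine lintegral_mono fun v => ?_
  dsimp only
  rw [lintegral_feError_reduction hz hS (fun i => b (v i)) (fun i => s (v i)) h]
  refine (lintegral_mono' hdg le_rfl).trans ?_
  rw [lintegral_smul_measure, smul_eq_mul]

/-- The reduction maps first-is-errorless LWE samples close to the LWE case of extended LWE. -/
theorem bind_reduction_feLWE_le (hU : U.det = 1 ∨ U.det = -1)
    (hz : ∀ j : Fin m, j ≠ 0 → ∑ i, z i * U i j = 0)
    (hS : U.map (Int.cast : ℤ → ℝ) * Matrix.diagonal (fun i => if i = 0 then 0 else 1) *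
      (U.map (Int.cast : ℤ → ℝ)).transpose + S * S.transpose =
      ξ ^ 2 • (1 : Matrix (Fin m) (Fin m) ℝ))
    (hdg : (Measure.pi fun _ : Fin m => contGauss (q * α * ξ)).bind (roundKernel m t) ≤
      c • dg.toMeasure) :
    ((PMF.uniformOfFintype (Fin n → ZMod q)).toMeasure.bind fun sec =>
      feLWE n m q sec (contGauss α)).bind (reduction n m q z U S α t) ≤
      c • extLWE₀ n m q dg z := by
  refine le_smul_of_lintegral_le fun h hh => ?_
  have hR : ∫⁻ y, h y ∂(extLWE₀ n m q dg z) =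
      ∫⁻ A, ∫⁻ sec, ∫⁻ w, h (A, fun i => A.transpose.mulVec sec i + ((w i : ℤ) : ZMod q),
        ∑ i, z i * w i) ∂dg.toMeasure ∂(PMF.uniformOfFintype (Fin n → ZMod q)).toMeasure
        ∂(PMF.uniformOfFintype (Matrix (Fin n) (Fin m) (ZMod q))).toMeasure := by
    simp_rw [extLWE₀, lintegral_toMeasure_bind, PMF.toMeasure_pure, lintegral_dirac]
  rw [Measure.lintegral_bind (reduction n m q z U S α t).aemeasurable hh.aemeasurable,
    Measure.lintegral_bind Measurable.of_discrete.aemeasurable hh.lintegral_kernel.aemeasurable, hR]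
  refine (lintegral_mono (g := fun sec => c * ∫⁻ A : Matrix (Fin n) (Fin m) (ZMod q), ∫⁻ w,
    h (A, fun i => A.transpose.mulVec sec i + ((w i : ℤ) : ZMod q),
      ∑ i, z i * w i) ∂dg.toMeasure
      ∂(PMF.uniformOfFintype (Matrix (Fin n) (Fin m) (ZMod q))).toMeasure) fun sec => ?_).trans ?_
  · dsimp only
    rw [feLWE_eq_pi]
    refine (lintegral_pi_blurred_reduction_le hz hS hdg (fun a => a)
      (fun a => ∑ j, a j * sec j) h).trans (le_of_eq ?_)
    refine congrArg (c * ·) (Eq.trans ?_ (lintegral_uniformOfFintype_comp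
      (bijective_sum_mul_of_unimodular hU n) fun A => ∫⁻ w, h (A,
        fun i => A.transpose.mulVec sec i + ((w i : ℤ) : ZMod q), ∑ i, z i * w i) ∂dg.toMeasure))
    refine lintegral_congr fun v => lintegral_congr fun w => ?_
    congr 3
    funext i
    congr 1
    simp only [Matrix.mulVec, dotProduct, Matrix.transpose_apply, Matrix.of_apply,
      Finset.mul_sum, Finset.sum_mul]
    rw [Finset.sum_comm]
    exact Finset.sum_congr rfl fun j _ => Finset.sum_congr rfl fun k _ => by ring
  · rw [lintegral_const_mul _ Measurable.of_discrete,
      lintegral_lintegral_swap Measurable.of_discrete.aemeasurable]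

/-- The reduction maps uniform points of `T_qⁿ × T_q` blurred by the noise close to the uniform case
of extended LWE. -/
theorem bind_reduction_blurred_le (hU : U.det = 1 ∨ U.det = -1)
    (hz : ∀ j : Fin m, j ≠ 0 → ∑ i, z i * U i j = 0)
    (hS : U.map (Int.cast : ℤ → ℝ) * Matrix.diagonal (fun i => if i = 0 then 0 else 1) *
      (U.map (Int.cast : ℤ → ℝ)).transpose + S * S.transpose =
      ξ ^ 2 • (1 : Matrix (Fin m) (Fin m) ℝ))
    (hdg : (Measure.pi fun _ : Fin m => contGauss (q * α * ξ)).bind (roundKernel m t) ≤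
      c • dg.toMeasure) :
    (Measure.pi fun i : Fin m =>
      ((PMF.uniformOfFintype ((Fin n → ZMod q) × ZMod q)).toMeasure.prod (feNoise α i)).map
        fun p => ((p.1.1, toT p.1.2 + ((p.2 : ℝ) : 𝕋)) : Samp n q)).bind
      (reduction n m q z U S α t) ≤ c • extLWE₁ n m q dg z := by
  refine le_smul_of_lintegral_le fun h hh => ?_
  have hR : ∫⁻ y, h y ∂(extLWE₁ n m q dg z) =
      ∫⁻ A, ∫⁻ b, ∫⁻ w, h (A, b, ∑ i, z i * w i) ∂dg.toMeasure
        ∂(PMF.uniformOfFintype (Fin m → ZMod q)).toMeasure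
        ∂(PMF.uniformOfFintype (Matrix (Fin n) (Fin m) (ZMod q))).toMeasure := by
    simp_rw [extLWE₁, lintegral_toMeasure_bind, PMF.toMeasure_pure, lintegral_dirac]
  rw [Measure.lintegral_bind (reduction n m q z U S α t).aemeasurable hh.aemeasurable, hR]
  refine (lintegral_pi_blurred_reduction_le hz hS hdg
    (fun a : (Fin n → ZMod q) × ZMod q => a.1) (fun a => a.2) h).trans (le_of_eq ?_)
  congr 1
  have hbij : Function.Bijective fun v : Fin m → (Fin n → ZMod q) × ZMod q =>
      ((Matrix.of fun j i => ∑ k, (U i k : ZMod q) * (v k).1 j,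
        fun i => ∑ k, (U i k : ZMod q) * (v k).2) :
        Matrix (Fin n) (Fin m) (ZMod q) × (Fin m → ZMod q)) :=
    ((bijective_sum_mul_of_unimodular hU n).prodMap (bijective_mulVec_of_unimodular hU)).comp
      (Equiv.arrowProdEquivProdArrow (Fin m) (fun _ => Fin n → ZMod q) fun _ => ZMod q).bijective
  have hcomp := lintegral_uniformOfFintype_comp hbij fun p => ∫⁻ w, h (p.1,
    fun i => p.2 i + ((w i : ℤ) : ZMod q), ∑ i, z i * w i) ∂dg.toMeasure
  refine hcomp.trans ?_
  rw [toMeasure_uniformOfFintype_prod, lintegral_prod _ Measurable.of_discrete.aemeasurable]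
  refine lintegral_congr fun A => ?_
  refine (lintegral_lintegral_swap Measurable.of_discrete.aemeasurable).trans
    (Eq.trans (lintegral_congr fun w => ?_)
      (lintegral_lintegral_swap Measurable.of_discrete.aemeasurable).symm)
  exact lintegral_uniformOfFintype_comp
    (Equiv.addRight fun i => ((w i : ℤ) : ZMod q)).bijective fun b => h (A, b, ∑ i, z i * w i)

end Reduction

instance (q : ℕ) [NeZero q] : IsProbabilityMeasure (uniTq q) :=
  inferInstanceAs (IsProbabilityMeasure (PMF.toMeasure _))

instance : IsProbabilityMeasure uniT :=
  ⟨UnitAddCircle.measure_univ⟩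

instance (n q : ℕ) [NeZero q] (s : Fin n → ZMod q) (φ : Measure ℝ) [IsProbabilityMeasure φ] :
    IsProbabilityMeasure (lweA n q s φ) :=
  Measure.isProbabilityMeasure_map (Measurable.aemeasurable (by
    have h₁ : Measurable fun p : (Fin n → ZMod q) × ℝ => toT (∑ j, p.1 j * s j) :=
      (Measurable.of_discrete (f := fun a : Fin n → ZMod q => toT (∑ j, a j * s j))).comp
        measurable_fst
    have h₂ : Measurable fun p : (Fin n → ZMod q) × ℝ => (p.2 : 𝕋) :=
      AddCircle.measurable_mk'.comp measurable_snd
    exact measurable_fst.prodMk (h₁.add h₂)))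

instance (n m q : ℕ) [NeZero m] [NeZero q] (s : Fin n → ZMod q) (φ : Measure ℝ)
    [IsProbabilityMeasure φ] : IsProbabilityMeasure (feLWE n m q s φ) := by
  have (i : Fin m) : IsProbabilityMeasure
      (if i = 0 then lweA n q s (Measure.dirac (0 : ℝ)) else lweA n q s φ) := by
    split_ifs <;> infer_instance
  exact inferInstanceAs (IsProbabilityMeasure (Measure.pi _))

instance (n q : ℕ) [NeZero q] : IsProbabilityMeasure (uniSamp n q) :=
  inferInstanceAs (IsProbabilityMeasure (Measure.prod _ _))

instance (n m q : ℕ) [NeZero m] [NeZero q] (i : Fin m) : IsProbabilityMeasure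
    (if i = 0 then ((PMF.uniformOfFintype (Fin n → ZMod q)).toMeasure).prod (uniTq q)
    else uniSamp n q) := by
  split_ifs <;> infer_instance

instance (n m q : ℕ) [NeZero m] [NeZero q] : IsProbabilityMeasure (feUni n m q) :=
  inferInstanceAs (IsProbabilityMeasure (Measure.pi _))

instance (n m q : ℕ) [NeZero q] (dg : PMF (Fin m → ℤ)) (z : Fin m → ℤ) :
    IsProbabilityMeasure (extLWE₀ n m q dg z) :=
  inferInstanceAs (IsProbabilityMeasure (PMF.toMeasure _))

instance (n m q : ℕ) [NeZero q] (dg : PMF (Fin m → ℤ)) (z : Fin m → ℤ) :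
    IsProbabilityMeasure (extLWE₁ n m q dg z) :=
  inferInstanceAs (IsProbabilityMeasure (PMF.toMeasure _))

theorem measurable_toT_add (q : ℕ) [NeZero q] :
    Measurable fun p : ZMod q × ℝ => toT p.1 + ((p.2 : ℝ) : 𝕋) :=
  ((Measurable.of_discrete (f := fun x : ZMod q => toT x)).comp measurable_fst).add
    (AddCircle.measurable_mk'.comp measurable_snd)

theorem map_uniformOfFintype_prod_prod (I : Type*) (q : ℕ) [NeZero q] [Fintype I] [Nonempty I]
    [MeasurableSpace I] [MeasurableSingletonClass I] (φ : Measure ℝ) [IsProbabilityMeasure φ] :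
    ((PMF.uniformOfFintype (I × ZMod q)).toMeasure.prod φ).map
        (fun p => (p.1.1, toT p.1.2 + ((p.2 : ℝ) : 𝕋))) =
      (PMF.uniformOfFintype I).toMeasure.prod
        (((PMF.uniformOfFintype (ZMod q)).toMeasure.prod φ).map
          fun p => toT p.1 + ((p.2 : ℝ) : 𝕋)) := by
  have h := measurable_toT_add q
  rw [toMeasure_uniformOfFintype_prod]
  nth_rw 2 [← Measure.map_id (μ := (PMF.uniformOfFintype I).toMeasure)]
  rw [Measure.map_prod_map _ _ measurable_id h, ← Measure.prodAssoc_prod,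
    Measure.map_map (measurable_id.prodMap h) MeasurableEquiv.prodAssoc.measurable]
  rfl

theorem uniTq_eq_map (q : ℕ) [NeZero q] :
    uniTq q = ((PMF.uniformOfFintype (ZMod q)).toMeasure.prod (Measure.dirac (0 : ℝ))).map
      fun p => toT p.1 + ((p.2 : ℝ) : 𝕋) := by
  have h := measurable_toT_add q
  rw [uniTq, ← PMF.toMeasure_map _ _ Measurable.of_discrete, Measure.prod_dirac,
    Measure.map_map h measurable_prodMk_right]
  congr 1
  funext x
  simp

/-- First-is-errorless uniform samples are dominated by blurred uniform points of `T_qⁿ × T_q`. -/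
theorem feUni_le {n m q : ℕ} [NeZero m] [NeZero q] {α η : ℝ} (hα : 0 < α) (hη0 : 0 ≤ η)
    (hη : η < 1)
    (hδ : 2 * Real.exp (-Real.pi * (q * α) ^ 2) / (1 - Real.exp (-Real.pi * (q * α) ^ 2)) ≤ η) :
    feUni n m q ≤ ENNReal.ofReal (1 - η)⁻¹ ^ m • Measure.pi fun i : Fin m =>
      ((PMF.uniformOfFintype ((Fin n → ZMod q) × ZMod q)).toMeasure.prod (feNoise α i)).map
        fun p => ((p.1.1, toT p.1.2 + ((p.2 : ℝ) : 𝕋)) : Samp n q) := by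
  rw [feUni]
  have hc : 1 ≤ ENNReal.ofReal (1 - η)⁻¹ := by
    rw [ENNReal.one_le_ofReal]
    exact (one_le_inv₀ (by linarith)).2 (by linarith)
  have := pi_le_smul_pi (c := ENNReal.ofReal (1 - η)⁻¹) ENNReal.ofReal_ne_top
    (μ := fun i : Fin m => if i = 0 then
      ((PMF.uniformOfFintype (Fin n → ZMod q)).toMeasure).prod (uniTq q) else uniSamp n q)
    (ν := fun i : Fin m =>
      ((PMF.uniformOfFintype ((Fin n → ZMod q) × ZMod q)).toMeasure.prod (feNoise α i)).map
        fun p => ((p.1.1, toT p.1.2 + ((p.2 : ℝ) : 𝕋)) : Samp n q)) fun i => ?_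
  · rwa [Fintype.card_fin] at this
  rw [map_uniformOfFintype_prod_prod, feNoise]
  split_ifs with hi
  · rw [← uniTq_eq_map]
    refine Measure.le_iff.2 fun s _ => ?_
    rw [Measure.smul_apply, smul_eq_mul]
    exact le_mul_of_one_le_left zero_le hc
  · rw [← Measure.prod_smul_right]
    exact Measure.prod_mono le_rfl (uniT_le_smul hα hη hδ)

/-- Pointwise domination of probability measures bounds every distinguishing advantage. -/
theorem abs_integral_sub_le_of_le_smul {X : Type*} [MeasurableSpace X] {μ ν : Measure X}
    [IsProbabilityMeasure μ] [IsProbabilityMeasure ν] {C : ℝ} (h : μ ≤ ENNReal.ofReal C • ν)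
    (hC : 1 ≤ C) {f : X → ℝ} (hf : IsDistinguisher f) :
    |∫ x, f x ∂μ - ∫ x, f x ∂ν| ≤ C - 1 := by
  have hgi {g : X → ℝ} (hg : IsDistinguisher g) (ρ : Measure X) [IsProbabilityMeasure ρ] :
      Integrable g ρ :=
    Integrable.of_mem_Icc 0 1 hg.1.aemeasurable (ae_of_all _ hg.2)
  have key {g : X → ℝ} (hg : IsDistinguisher g) : ∫ x, g x ∂μ - ∫ x, g x ∂ν ≤ C - 1 := by
    have h1 : ∫ x, g x ∂μ ≤ C * ∫ x, g x ∂ν := by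
      refine (integral_mono_measure h (ae_of_all _ fun x => (hg.2 x).1)
        ((hgi hg ν).smul_measure ENNReal.ofReal_ne_top)).trans_eq ?_
      rw [integral_smul_measure, ENNReal.toReal_ofReal (by linarith), smul_eq_mul]
    have h2 : ∫ x, g x ∂ν ≤ 1 := by
      simpa using integral_mono (hgi hg ν) (integrable_const 1) fun x => (hg.2 x).2
    nlinarith
  refine abs_le.2 ⟨?_, key hf⟩
  have h1 := key (g := fun x => 1 - f x) ⟨measurable_const.sub hf.1, fun x =>
    ⟨by linarith [(hf.2 x).2], by linarith [(hf.2 x).1]⟩⟩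
  rw [integral_sub (integrable_const 1) (hgi hf μ),
    integral_sub (integrable_const 1) (hgi hf ν)] at h1
  simp only [integral_const, probReal_univ, smul_eq_mul, mul_one] at h1
  linarith

theorem adv_sub_le {X : Type*} [MeasurableSpace X] {μ₀ μ₁ ν₀ ν₁ : Measure X}
    [IsProbabilityMeasure μ₀] [IsProbabilityMeasure μ₁] [IsProbabilityMeasure ν₀]
    [IsProbabilityMeasure ν₁] {C₀ C₁ : ℝ} (h₀ : μ₀ ≤ ENNReal.ofReal C₀ • ν₀)
    (h₁ : μ₁ ≤ ENNReal.ofReal C₁ • ν₁) (hC₀ : 1 ≤ C₀) (hC₁ : 1 ≤ C₁) {f : X → ℝ}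
    (hf : IsDistinguisher f) : adv f ν₀ ν₁ - ((C₀ - 1) + (C₁ - 1)) ≤ adv f μ₀ μ₁ := by
  have a₀ := abs_integral_sub_le_of_le_smul h₀ hC₀ hf
  have a₁ := abs_integral_sub_le_of_le_smul h₁ hC₁ hf
  have a₂ := abs_sub_abs_le_abs_sub (∫ x, f x ∂ν₀ - ∫ x, f x ∂ν₁) (∫ x, f x ∂μ₀ - ∫ x, f x ∂μ₁)
  rw [show ∫ x, f x ∂ν₀ - ∫ x, f x ∂ν₁ - (∫ x, f x ∂μ₀ - ∫ x, f x ∂μ₁) =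
    ∫ x, f x ∂μ₁ - ∫ x, f x ∂ν₁ - (∫ x, f x ∂μ₀ - ∫ x, f x ∂ν₀) by ring] at a₂
  have a₃ := abs_sub (∫ x, f x ∂μ₁ - ∫ x, f x ∂ν₁) (∫ x, f x ∂μ₀ - ∫ x, f x ∂ν₀)
  rw [adv, adv]
  linarith

theorem adv_le_one {X : Type*} [MeasurableSpace X] (μ ν : Measure X) [IsProbabilityMeasure μ]
    [IsProbabilityMeasure ν] {f : X → ℝ} (hf : IsDistinguisher f) : adv f μ ν ≤ 1 := by
  have h (ρ : Measure X) [IsProbabilityMeasure ρ] :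
      0 ≤ ∫ x, f x ∂ρ ∧ ∫ x, f x ∂ρ ≤ 1 := by
    refine ⟨integral_nonneg fun x => (hf.2 x).1, ?_⟩
    simpa using integral_mono (Integrable.of_mem_Icc 0 1 hf.1.aemeasurable (ae_of_all ρ hf.2))
      (integrable_const 1) fun x => (hf.2 x).2
  exact abs_sub_le_iff.2 ⟨by linarith [h μ, (h μ).2, (h ν).1], by linarith [(h ν).2, (h μ).1]⟩

theorem reduction_loss_le {m : ℕ} (hm : 1 ≤ m) {ε : ℝ} (hε : 0 < ε) (hε' : ε ≤ 2 / 33) :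
    (((1 + ε / m) / (1 - ε / m)) ^ m - 1) +
      (((1 - ε / m)⁻¹) ^ m * ((1 + ε / m) / (1 - ε / m)) ^ m - 1) ≤ 33 * ε / 2 := by
  have hm' : (1 : ℝ) ≤ m := by exact_mod_cast hm
  set η := ε / m with hη
  have hηm : m * η = ε := by rw [hη]; field_simp
  have hη0 : 0 < η := by positivity
  have hη1 : η ≤ ε := div_le_self hε.le hm'
  have hb : 1 - ε ≤ (1 - η) ^ m := by
    have := one_add_mul_le_pow (a := -η) (by linarith) m
    rw [← sub_eq_add_neg] at this
    linarith
  have h1 : 0 < 1 - η := by linarith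
  have hE : 0 < 1 - ε := by linarith
  have hx : ((1 - η)⁻¹) ^ m ≤ (1 - ε)⁻¹ := by
    rw [inv_pow]; exact inv_anti₀ hE hb
  have hx0 : 0 ≤ ((1 - η)⁻¹) ^ m := by positivity
  have hr : ((1 + η) / (1 - η)) ^ m ≤ (((1 - η)⁻¹) ^ m) ^ 2 := by
    rw [← pow_mul, mul_comm m 2, pow_mul]
    refine pow_le_pow_left₀ (by positivity) ?_ m
    rw [inv_pow, div_le_iff₀ h1, inv_mul_eq_div, le_div_iff₀ (by positivity)]
    nlinarith [mul_pos hη0 hη0, mul_pos (mul_pos hη0 hη0) h1]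
  have hy : (1 - ε)⁻¹ ≤ 1 + 33 / 31 * ε := by
    rw [inv_le_iff_one_le_mul₀ hE]
    nlinarith
  generalize ((1 - η)⁻¹) ^ m = x at *
  have hx2 : x ≤ 1 + 33 / 31 * ε := hx.trans hy
  have hsq : x ^ 2 ≤ (1 + 33 / 31 * ε) ^ 2 := pow_le_pow_left₀ hx0 hx2 2
  have hcu : x ^ 3 ≤ (1 + 33 / 31 * ε) ^ 3 := pow_le_pow_left₀ hx0 hx2 3
  have hxr := mul_le_mul_of_nonneg_left hr hx0
  nlinarith [mul_pos hε hε, mul_pos (mul_pos hε hε) hε]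

/-- **Lemma 4.7 (hardness of extended LWE).** Let `Z ⊆ ℤ^m` be of quality `ξ > 0`, let
`n, q ≥ 1`, `ε ∈ (0,1/2)` and `α, r ≥ √(ln(2m(1+1/ε))/π)/q`.  For every `z ∈ Z` there is
a randomized transformation (a Markov kernel) mapping `m` samples of the
first-is-errorless LWE distribution (dimension `n`, modulus `q`, noise `D_α`) to an
`extLWE` tuple, such that every distinguisher `f` for `extLWE_{n,m,q,(α²ξ²+r²)^{1/2},Z}`
with hint vector `z` and advantage `ζ` yields, by composition with the transformation, a
distinguisher for the first-is-errorless variant of `LWE_{n,m,q,α}` with advantage at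
least `ζ − 33ε/2`. -/
theorem extLWE_reduction (n m q : ℕ) [NeZero m] [NeZero q]
    (hn : 1 ≤ n) (hm : 1 ≤ m) (hq : 1 ≤ q)
    (ξ : ℝ) (hξ : 0 < ξ) (Z : Set (Fin m → ℤ)) (hZ : ∀ z ∈ Z, QualityAt ξ z)
    (ε α r : ℝ) (hε : 0 < ε) (hε' : ε < 1 / 2)
    (hα : Real.sqrt (Real.log (2 * m * (1 + 1 / ε)) / Real.pi) / q ≤ α)
    (hr : Real.sqrt (Real.log (2 * m * (1 + 1 / ε)) / Real.pi) / q ≤ r) :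
    ∀ z ∈ Z, ∀ dg : PMF (Fin m → ℤ),
      IsDiscreteGaussian dg ((q : ℝ) * Real.sqrt (α ^ 2 * ξ ^ 2 + r ^ 2)) →
      ∃ κ : Kernel (Fin m → Samp n q)
          (Matrix (Fin n) (Fin m) (ZMod q) × (Fin m → ZMod q) × ℤ),
        IsMarkovKernel κ ∧
        ∀ f : (Matrix (Fin n) (Fin m) (ZMod q) × (Fin m → ZMod q) × ℤ) → ℝ,
          IsDistinguisher f →
          adv f (extLWE₀ n m q dg z) (extLWE₁ n m q dg z) - 33 * ε / 2
            ≤ adv f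
                (((PMF.uniformOfFintype (Fin n → ZMod q)).toMeasure.bind fun sec =>
                  feLWE n m q sec (contGauss α)).bind fun x => κ x)
                ((feUni n m q).bind fun x => κ x) := by
  intro z hzZ dg hdg
  obtain ⟨U, hU, hz, hsing⟩ := hZ z hzZ
  obtain ⟨S, hS⟩ := exists_noise_completion (U.map (Int.cast : ℤ → ℝ)) hsing
  have hq0 : (0 : ℝ) < q := by exact_mod_cast hq
  have hm0 : (1 : ℝ) ≤ m := by exact_mod_cast hm
  obtain ⟨hα0, hα1⟩ := smoothing_numeric hm hε (t := q * α) ((div_le_iff₀' hq0).1 hα)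
  obtain ⟨hr0, hr1⟩ := smoothing_numeric hm hε (t := q * r) ((div_le_iff₀' hq0).1 hr)
  have hη0 : 0 ≤ ε / m := by positivity
  have hη1 : ε / m < 1 := (div_le_self hε.le hm0).trans_lt (by linarith)
  have hη2 : 0 < 1 - ε / m := by linarith
  have := roundKernel_isMarkovKernel (m := m) (gaussTotal_ne_top hr0 hη1 hr1)
  have := reduction_isMarkovKernel (n := n) (q := q) z U S α (q * r)
  refine ⟨reduction n m q z U S α (q * r), this, fun f hf => ?_⟩
  have : IsProbabilityMeasure ((PMF.uniformOfFintype (Fin n → ZMod q)).toMeasure.bind fun sec =>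
      feLWE n m q sec (contGauss α)) :=
    isProbabilityMeasure_bind Measurable.of_discrete.aemeasurable
      (ae_of_all _ fun _ => inferInstance)
  have : IsProbabilityMeasure (((PMF.uniformOfFintype (Fin n → ZMod q)).toMeasure.bind fun sec =>
      feLWE n m q sec (contGauss α)).bind (reduction n m q z U S α (q * r))) := inferInstance
  have : IsProbabilityMeasure ((feUni n m q).bind (reduction n m q z U S α (q * r))) :=
    inferInstance
  rcases le_total ε (2 / 33) with hε2 | hε2
  swap
  · have h1 := adv_le_one (extLWE₀ n m q dg z) (extLWE₁ n m q dg z) hf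
    refine le_trans ?_ (abs_nonneg _)
    linarith
  have hround := hdg.bind_roundKernel_le (A := q * α * ξ) (by positivity) hr0 hη0 hη1
    (by rw [mul_pow, Real.sq_sqrt (by positivity)]; ring) hr1
  have h₀ := bind_reduction_feLWE_le (n := n) hU hz hS hround
  have h₁ := bind_reduction_blurred_le (n := n) hU hz hS hround
  have h₂ : (feUni n m q).bind (reduction n m q z U S α (q * r)) ≤
      (ENNReal.ofReal (1 - ε / m)⁻¹ ^ m * ENNReal.ofReal ((1 + ε / m) / (1 - ε / m)) ^ m) •
        extLWE₁ n m q dg z := by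
    have hα2 : 0 < α := pos_of_mul_pos_right hα0 hq0.le
    refine le_smul_of_lintegral_le fun h hh => ?_
    rw [Measure.lintegral_bind (Kernel.aemeasurable _) hh.aemeasurable, mul_assoc]
    refine (lintegral_mono' (feUni_le hα2 hη0 hη1 hα1) le_rfl).trans ?_
    rw [lintegral_smul_measure, smul_eq_mul,
      ← Measure.lintegral_bind (Kernel.aemeasurable _) hh.aemeasurable]
    refine mul_le_mul_right ((lintegral_mono' h₁ le_rfl).trans_eq ?_) _
    rw [lintegral_smul_measure, smul_eq_mul]
  have hone : 1 ≤ ((1 + ε / m) / (1 - ε / m)) ^ m :=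
    one_le_pow₀ ((one_le_div hη2).2 (by linarith))
  have hone' : 1 ≤ ((1 - ε / m)⁻¹) ^ m := one_le_pow₀ ((one_le_inv₀ hη2).2 (by linarith))
  rw [← ENNReal.ofReal_pow (by positivity)] at h₀ h₂
  rw [← ENNReal.ofReal_pow (by positivity), ← ENNReal.ofReal_mul (by positivity)] at h₂
  have hadv := adv_sub_le h₀ h₂ hone (one_le_mul_of_one_le_of_one_le hone' hone) hf
  have hloss := reduction_loss_le hm hε hε2
  linarith

end LWEPaper
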